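/- Let γ be a subalgebra of P^d and let V_γ = {x ∈ M^d : p(x) = 0 for all p ∈ γ}. Let δ be a J×J matrix of free polynomials such that V_γ ∩ G_δ is nonempty, and let f be a bounded free holomorphic function on V_γ ∩ G_δ. Then there exists a free holomorphic function φ on G_δ that extends f and satisfies ‖φ‖_{H^∞(G_δ)} = sup{‖f(x)‖ : x ∈ V_γ ∩ G_δ}. -/

import Mathlib

/- ## Basic framework for free (nc) function theory -/

noncomputable section

/-- A point of `M_n^d`: a `d`-tuple of `n × n` complex matrices. -/
abbrev MatTuple (d n : ℕ) : Type := Fin d → Matrix (Fin n) (Fin n) ℂ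

/-- Evaluation of a free polynomial `p ∈ P^d` at a `d`-tuple of `n × n` matrices:
the unital algebra homomorphism sending the `r`-th variable to `x r`. -/
noncomputable def evalPoly {d n : ℕ} (p : FreeAlgebra ℂ (Fin d)) (x : MatTuple d n) :
    Matrix (Fin n) (Fin n) ℂ :=
  FreeAlgebra.lift ℂ x p

/-- The operator norm (`ℓ² → ℓ²`) of a square complex matrix. -/
noncomputable def opNorm {ι : Type*} [Fintype ι] [DecidableEq ι] (A : Matrix ι ι ℂ) : ℝ :=
  ‖Matrix.toEuclideanCLM (𝕜 := ℂ) A‖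

/-- Evaluation of a `J × J` matrix `δ` of free polynomials at `x ∈ M_n^d`:
the `Jn × Jn` matrix whose `(i,j)` block is `δ i j` evaluated at `x`. -/
noncomputable def evalMat {d n J : ℕ} (δ : Matrix (Fin J) (Fin J) (FreeAlgebra ℂ (Fin d)))
    (x : MatTuple d n) : Matrix (Fin J × Fin n) (Fin J × Fin n) ℂ :=
  fun a b => evalPoly (δ a.1 b.1) x a.2 b.2

/-- The basic free open set `G_δ = {x : ‖δ(x)‖ < 1}`, at matrix size `n`. -/
noncomputable def Gdel {d J : ℕ} (δ : Matrix (Fin J) (Fin J) (FreeAlgebra ℂ (Fin d))) (n : ℕ) :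
    Set (MatTuple d n) :=
  {x | opNorm (evalMat δ x) < 1}

/-- Direct sum of two square complex matrices. -/
def mdsum {m n : ℕ} (A : Matrix (Fin m) (Fin m) ℂ) (B : Matrix (Fin n) (Fin n) ℂ) :
    Matrix (Fin (m + n)) (Fin (m + n)) ℂ :=
  Matrix.reindex finSumFinEquiv finSumFinEquiv (Matrix.fromBlocks A 0 0 B)

/-- Direct sum of two tuples of matrices (coordinatewise direct sum). -/
def tdsum {d m n : ℕ} (x : MatTuple d m) (y : MatTuple d n) : MatTuple d (m + n) :=
  fun r => mdsum (x r) (y r)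

/-- `φ` is an nc-function on the graded domain `D`: it preserves direct sums
and similarities. -/
structure IsNCFn {d : ℕ} (D : ∀ n, Set (MatTuple d n))
    (φ : ∀ n, MatTuple d n → Matrix (Fin n) (Fin n) ℂ) : Prop where
  map_dsum : ∀ {m n : ℕ} (x : MatTuple d m) (y : MatTuple d n),
      x ∈ D m → y ∈ D n → tdsum x y ∈ D (m + n) →
      φ (m + n) (tdsum x y) = mdsum (φ m x) (φ n y)
  map_sim : ∀ {n : ℕ} (x : MatTuple d n) (s : Matrix (Fin n) (Fin n) ℂ),
      IsUnit s → x ∈ D n → (fun r => s⁻¹ * x r * s) ∈ D n →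
      φ n (fun r => s⁻¹ * x r * s) = s⁻¹ * φ n x * s

/-- `φ` is bounded by `C` on the graded domain `D`. -/
def BddBy {d : ℕ} (D : ∀ n, Set (MatTuple d n))
    (φ : ∀ n, MatTuple d n → Matrix (Fin n) (Fin n) ℂ) (C : ℝ) : Prop :=
  ∀ n, ∀ x ∈ D n, opNorm (φ n x) ≤ C

/-- `D` is open in the free topology: every point has a basic free open
neighbourhood contained in `D`. -/
def IsFreeOpen {d : ℕ} (D : ∀ n, Set (MatTuple d n)) : Prop :=
  ∀ n, ∀ x ∈ D n, ∃ (J : ℕ) (δ : Matrix (Fin J) (Fin J) (FreeAlgebra ℂ (Fin d))),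
    x ∈ Gdel δ n ∧ ∀ m, Gdel δ m ⊆ D m

/-- `φ` is a free holomorphic function on the free open set `U`: every point of `U`
lies in a basic free open subset of `U` on which `φ` is a bounded nc-function. -/
def IsFreeHolo {d : ℕ} (U : ∀ n, Set (MatTuple d n))
    (φ : ∀ n, MatTuple d n → Matrix (Fin n) (Fin n) ℂ) : Prop :=
  ∀ n, ∀ x ∈ U n, ∃ (J : ℕ) (δ : Matrix (Fin J) (Fin J) (FreeAlgebra ℂ (Fin d))),
    x ∈ Gdel δ n ∧ (∀ m, Gdel δ m ⊆ U m) ∧ IsNCFn (Gdel δ) φ ∧ ∃ C, BddBy (Gdel δ) φ C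

/-- `φ` belongs to the closed unit ball of `H^∞(U)`. -/
def MemBallHinf {d : ℕ} (U : ∀ n, Set (MatTuple d n))
    (φ : ∀ n, MatTuple d n → Matrix (Fin n) (Fin n) ℂ) : Prop :=
  IsFreeHolo U φ ∧ BddBy U φ 1

/-- The variety `V_Λ` determined by `Λ` (at matrix size `m`): common zero set of
the free polynomials annihilating `Λ`. -/
def VLam {d n : ℕ} (Λ : MatTuple d n) (m : ℕ) : Set (MatTuple d m) :=
  {x | ∀ p : FreeAlgebra ℂ (Fin d), evalPoly p Λ = 0 → evalPoly p x = 0}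

end

open Matrix

/-- The squared Euclidean length of a complex vector. -/
noncomputable def nsq {ι : Type*} [Fintype ι] (v : ι → ℂ) : ℝ := ∑ i, ‖v i‖ ^ 2

section EuclideanLength

variable {ι κ : Type*} [Fintype ι] [Fintype κ]

lemma nsq_nonneg (v : ι → ℂ) : 0 ≤ nsq v :=
  Finset.sum_nonneg fun _ _ => by positivity

lemma nsq_eq_zero {v : ι → ℂ} : nsq v = 0 ↔ v = 0 := by
  unfold nsq
  rw [Finset.sum_eq_zero_iff_of_nonneg fun _ _ => by positivity]
  simp [funext_iff]

lemma nsq_pos {v : ι → ℂ} (hv : v ≠ 0) : 0 < nsq v :=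
  lt_of_le_of_ne (nsq_nonneg v) fun h => hv (nsq_eq_zero.1 h.symm)

lemma nsq_eq_norm_sq (v : ι → ℂ) : nsq v = ‖WithLp.toLp 2 v‖ ^ 2 := by
  rw [EuclideanSpace.norm_sq_eq]
  rfl

lemma nsq_eq_dotProduct (v : ι → ℂ) : (nsq v : ℂ) = star v ⬝ᵥ v := by
  simp [nsq, dotProduct, Complex.conj_mul']

lemma nsq_prod (v : ι × κ → ℂ) : nsq v = ∑ i, nsq fun j => v (i, j) := by
  simp [nsq, Fintype.sum_prod_type]

lemma nsq_comp_equiv (e : κ ≃ ι) (v : ι → ℂ) : nsq (v ∘ e) = nsq v :=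
  Equiv.sum_comp e fun i => ‖v i‖ ^ 2

variable [DecidableEq ι]

lemma opNorm_nonneg (A : Matrix ι ι ℂ) : 0 ≤ opNorm A := norm_nonneg _

lemma opNorm_le_iff {A : Matrix ι ι ℂ} {c : ℝ} (hc : 0 ≤ c) :
    opNorm A ≤ c ↔ ∀ v, nsq (A *ᵥ v) ≤ c ^ 2 * nsq v := by
  unfold opNorm
  rw [ContinuousLinearMap.opNorm_le_iff hc]
  simp only [nsq_eq_norm_sq, ← mul_pow]
  constructor
  · intro h v
    gcongr
    exact h (WithLp.toLp 2 v)
  · intro h v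
    exact (sq_le_sq₀ (norm_nonneg _) (by positivity)).1 (h v.ofLp)

lemma nsq_mulVec_le (A : Matrix ι ι ℂ) (v : ι → ℂ) :
    nsq (A *ᵥ v) ≤ opNorm A ^ 2 * nsq v :=
  (opNorm_le_iff (opNorm_nonneg A)).1 le_rfl v

lemma opNorm_lt_one_iff {A : Matrix ι ι ℂ} :
    opNorm A < 1 ↔ ∀ v, v ≠ 0 → nsq (A *ᵥ v) < nsq v := by
  constructor
  · intro h v hv
    have h1 := nsq_mulVec_le A v
    have h2 : opNorm A ^ 2 < 1 := by
      have := opNorm_nonneg A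
      nlinarith
    nlinarith [nsq_pos hv]
  · intro h
    rcases isEmpty_or_nonempty ι with hι | hι
    · have : opNorm A ≤ 0 := (opNorm_le_iff le_rfl).2 fun v => by simp [nsq]
      linarith
    · set T := Matrix.toEuclideanCLM (𝕜 := ℂ) A
      have hne : (Metric.sphere (0 : EuclideanSpace ℂ ι) 1).Nonempty :=
        NormedSpace.sphere_nonempty.2 zero_le_one
      obtain ⟨w, hw, hmax⟩ := (isCompact_sphere (0 : EuclideanSpace ℂ ι) 1).exists_isMaxOn hne
        (f := fun v => ‖T v‖) (by fun_prop)
      have hw1 : ‖w‖ = 1 := by simpa using hw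
      have hlt : ‖T w‖ < 1 := by
        have := h w.ofLp (by
          intro h0
          have : w = 0 := by ext i; exact congrFun h0 i
          simp [this] at hw1)
        rw [nsq_eq_norm_sq, nsq_eq_norm_sq] at this
        have h3 : ‖T w‖ ^ 2 < ‖w‖ ^ 2 := this
        rw [hw1] at h3
        nlinarith [norm_nonneg (T w)]
      refine lt_of_le_of_lt ?_ hlt
      refine ContinuousLinearMap.opNorm_le_of_unit_norm (𝕜 := ℂ) (norm_nonneg _) fun v hv => ?_
      exact hmax (by simpa using hv)

end EuclideanLength

section Evaluation

variable {d J : ℕ}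

lemma evalPoly_map {m n : ℕ} (ρ : Matrix (Fin m) (Fin m) ℂ →ₐ[ℂ] Matrix (Fin n) (Fin n) ℂ)
    (p : FreeAlgebra ℂ (Fin d)) (x : MatTuple d m) :
    evalPoly p (fun r => ρ (x r)) = ρ (evalPoly p x) := by
  have : FreeAlgebra.lift ℂ (fun r => ρ (x r)) = ρ.comp (FreeAlgebra.lift ℂ x) := by
    ext r; simp
  simpa [evalPoly] using congrArg (fun g => g p) this

lemma evalMat_apply {n : ℕ} (δ : Matrix (Fin J) (Fin J) (FreeAlgebra ℂ (Fin d)))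
    (x : MatTuple d n) (a b : Fin J × Fin n) :
    evalMat δ x a b = evalPoly (δ a.1 b.1) x a.2 b.2 := rfl

section DirectSum

variable {m n : ℕ}

@[simp] lemma mdsum_castAdd_castAdd (A : Matrix (Fin m) (Fin m) ℂ) (B : Matrix (Fin n) (Fin n) ℂ)
    (i j : Fin m) : mdsum A B (Fin.castAdd n i) (Fin.castAdd n j) = A i j := by
  simp [mdsum]

@[simp] lemma mdsum_castAdd_natAdd (A : Matrix (Fin m) (Fin m) ℂ) (B : Matrix (Fin n) (Fin n) ℂ)
    (i : Fin m) (j : Fin n) : mdsum A B (Fin.castAdd n i) (Fin.natAdd m j) = 0 := by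
  simp [mdsum]

@[simp] lemma mdsum_natAdd_castAdd (A : Matrix (Fin m) (Fin m) ℂ) (B : Matrix (Fin n) (Fin n) ℂ)
    (i : Fin n) (j : Fin m) : mdsum A B (Fin.natAdd m i) (Fin.castAdd n j) = 0 := by
  simp [mdsum]

@[simp] lemma mdsum_natAdd_natAdd (A : Matrix (Fin m) (Fin m) ℂ) (B : Matrix (Fin n) (Fin n) ℂ)
    (i j : Fin n) : mdsum A B (Fin.natAdd m i) (Fin.natAdd m j) = B i j := by
  simp [mdsum]

lemma ext_castAdd_natAdd {A B : Matrix (Fin (m + n)) (Fin (m + n)) ℂ}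
    (h₁ : ∀ i j, A (Fin.castAdd n i) (Fin.castAdd n j) = B (Fin.castAdd n i) (Fin.castAdd n j))
    (h₂ : ∀ i j, A (Fin.castAdd n i) (Fin.natAdd m j) = B (Fin.castAdd n i) (Fin.natAdd m j))
    (h₃ : ∀ i j, A (Fin.natAdd m i) (Fin.castAdd n j) = B (Fin.natAdd m i) (Fin.castAdd n j))
    (h₄ : ∀ i j, A (Fin.natAdd m i) (Fin.natAdd m j) = B (Fin.natAdd m i) (Fin.natAdd m j)) :
    A = B := by
  ext i j
  refine Fin.addCases (fun i => ?_) (fun i => ?_) i <;>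
    refine Fin.addCases (fun j => ?_) (fun j => ?_) j
  exacts [h₁ i j, h₂ i j, h₃ i j, h₄ i j]

lemma mdsum_injective {A A' : Matrix (Fin m) (Fin m) ℂ} {B B' : Matrix (Fin n) (Fin n) ℂ}
    (h : mdsum A B = mdsum A' B') : A = A' ∧ B = B' := by
  constructor
  · ext i j
    simpa using congrFun (congrFun h (Fin.castAdd n i)) (Fin.castAdd n j)
  · ext i j
    simpa using congrFun (congrFun h (Fin.natAdd m i)) (Fin.natAdd m j)

/-- The direct sum of matrices as an algebra homomorphism. -/
noncomputable def mdsumHom (m n : ℕ) : Matrix (Fin m) (Fin m) ℂ × Matrix (Fin n) (Fin n) ℂ →ₐ[ℂ]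
    Matrix (Fin (m + n)) (Fin (m + n)) ℂ :=
  AlgHom.ofLinearMap
    { toFun := fun A => mdsum A.1 A.2
      map_add' := fun A B => by apply ext_castAdd_natAdd <;> simp
      map_smul' := fun c A => by apply ext_castAdd_natAdd <;> simp }
    (by apply ext_castAdd_natAdd <;> simp [Matrix.one_apply, Fin.ext_iff]; all_goals omega)
    (fun A B => by apply ext_castAdd_natAdd <;> simp [Matrix.mul_apply, Fin.sum_univ_add])

@[simp] lemma mdsumHom_apply (A : Matrix (Fin m) (Fin m) ℂ × Matrix (Fin n) (Fin n) ℂ) :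
    mdsumHom m n A = mdsum A.1 A.2 := rfl

lemma evalPoly_tdsum (p : FreeAlgebra ℂ (Fin d)) (x : MatTuple d m) (y : MatTuple d n) :
    evalPoly p (tdsum x y) = mdsum (evalPoly p x) (evalPoly p y) := by
  have : FreeAlgebra.lift ℂ (tdsum x y) =
      (mdsumHom m n).comp ((FreeAlgebra.lift ℂ x).prod (FreeAlgebra.lift ℂ y)) := by
    ext r; simp [tdsum]
  simpa [evalPoly] using congrArg (fun g => g p) this

lemma nsq_add_split (v : Fin J × Fin (m + n) → ℂ) :
    nsq v = nsq (fun a : Fin J × Fin m => v (a.1, Fin.castAdd n a.2)) +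
      nsq (fun a : Fin J × Fin n => v (a.1, Fin.natAdd m a.2)) := by
  simp [nsq, Fintype.sum_prod_type, Fin.sum_univ_add, Finset.sum_add_distrib]

variable (δ : Matrix (Fin J) (Fin J) (FreeAlgebra ℂ (Fin d)))

lemma nsq_evalMat_tdsum (x : MatTuple d m) (y : MatTuple d n) (v : Fin J × Fin (m + n) → ℂ) :
    nsq (evalMat δ (tdsum x y) *ᵥ v) =
      nsq (evalMat δ x *ᵥ fun a => v (a.1, Fin.castAdd n a.2)) +
      nsq (evalMat δ y *ᵥ fun a => v (a.1, Fin.natAdd m a.2)) := by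
  rw [nsq_add_split]
  unfold mulVec dotProduct
  simp [evalMat_apply, evalPoly_tdsum, Fintype.sum_prod_type, Fin.sum_univ_add]

variable {δ}

lemma tdsum_mem_Gdel_iff {x : MatTuple d m} {y : MatTuple d n} :
    tdsum x y ∈ Gdel δ (m + n) ↔ x ∈ Gdel δ m ∧ y ∈ Gdel δ n := by
  simp only [Gdel, Set.mem_ofPred_eq, opNorm_lt_one_iff]
  constructor
  · intro h
    constructor
    · intro v hv
      have := h (fun a => Fin.addCases (fun i => v (a.1, i)) (fun _ => 0) a.2) (by
        intro h0
        apply hv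
        ext a
        simpa using congrFun h0 (a.1, Fin.castAdd n a.2))
      rw [nsq_evalMat_tdsum, nsq_add_split] at this
      simpa [nsq, mulVec, dotProduct] using this
    · intro v hv
      have := h (fun a => Fin.addCases (fun _ => 0) (fun i => v (a.1, i)) a.2) (by
        intro h0
        apply hv
        ext a
        simpa using congrFun h0 (a.1, Fin.natAdd m a.2))
      rw [nsq_evalMat_tdsum, nsq_add_split] at this
      simpa [nsq, mulVec, dotProduct] using this
  · rintro ⟨hx, hy⟩ v hv
    rw [nsq_evalMat_tdsum, nsq_add_split]
    have key : ∀ {k : ℕ} {z : MatTuple d k},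
        (∀ w, w ≠ 0 → nsq (evalMat δ z *ᵥ w) < nsq w) → ∀ w, nsq (evalMat δ z *ᵥ w) ≤ nsq w := by
      intro k z hz w
      by_cases hw : w = 0
      · simp [hw, nsq]
      · exact (hz w hw).le
    by_cases h1 : (fun a : Fin J × Fin m => v (a.1, Fin.castAdd n a.2)) = 0
    · refine add_lt_add_of_le_of_lt (key hx _) (hy _ fun h2 => hv ?_)
      ext ⟨j, i⟩
      refine Fin.addCases (fun i => ?_) (fun i => ?_) i
      · exact congrFun h1 (j, i)
      · exact congrFun h2 (j, i)
    · exact add_lt_add_of_lt_of_le (hx _ h1) (key hy _)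

end DirectSum

end Evaluation

section PositiveCone

open scoped ComplexOrder

variable {ι κ J : Type*} [Fintype J]

lemma isCompact_setOf_entries_le (ι κ : Type*) (r : ℝ) :
    IsCompact {A : Matrix ι κ ℂ | ∀ a b, ‖A a b‖ ≤ r} := by
  have h : {A : Matrix ι κ ℂ | ∀ a b, ‖A a b‖ ≤ r} =
      Set.univ.pi fun _ => Set.univ.pi fun _ => Metric.closedBall (0 : ℂ) r := by
    apply Set.ext
    intro A
    exact ⟨fun h a _ b _ => by simpa using h a b,
      fun h a b => by simpa using h a (Set.mem_univ a) b (Set.mem_univ b)⟩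
  rw [h]
  exact isCompact_univ_pi fun _ => isCompact_univ_pi fun _ => isCompact_closedBall _ _

/-- The partial trace over the first tensor factor. -/
noncomputable def partialTrace :
    Matrix (J × ι) (J × ι) ℂ →ₗ[ℂ] Matrix ι ι ℂ where
  toFun P := Matrix.of fun a b => ∑ j, P (j, a) (j, b)
  map_add' P Q := by ext; simp [Finset.sum_add_distrib]
  map_smul' c P := by ext; simp [Finset.mul_sum]

lemma partialTrace_apply (P : Matrix (J × ι) (J × ι) ℂ) (a b : ι) :
    partialTrace P a b = ∑ j, P (j, a) (j, b) := rfl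

lemma continuous_partialTrace :
    Continuous (partialTrace : Matrix (J × ι) (J × ι) ℂ → Matrix ι ι ℂ) := by
  refine continuous_matrix fun a b => ?_
  simp only [partialTrace_apply]
  fun_prop

lemma conjTranspose_partialTrace (P : Matrix (J × ι) (J × ι) ℂ) :
    (partialTrace P)ᴴ = partialTrace Pᴴ := by
  ext a b
  simp [partialTrace_apply]

variable [Fintype ι] [Fintype κ]

lemma trace_partialTrace (P : Matrix (J × ι) (J × ι) ℂ) :
    (partialTrace P).trace = P.trace := by
  simp [Matrix.trace, partialTrace_apply, Fintype.sum_prod_type_right]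

lemma trace_mul_conjTranspose_self_re (R : Matrix ι κ ℂ) :
    (R * Rᴴ).trace.re = ∑ k, nsq (R.col k) := by
  rw [Matrix.trace_mul_comm]
  simp [Matrix.trace, Matrix.mul_apply, nsq, Complex.conj_mul', ← Complex.ofReal_pow]

lemma trace_vecMulVec_mul (G : Matrix ι ι ℂ) (v : ι → ℂ) :
    (vecMulVec v (star v) * G).trace = star v ⬝ᵥ G *ᵥ v := by
  rw [vecMulVec_mul, trace_vecMulVec, dotProduct_mulVec, dotProduct_comm]

lemma trace_partialTrace_vecMulVec_mul (G : Matrix ι ι ℂ) (u : J × ι → ℂ) :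
    (partialTrace (vecMulVec u (star u)) * G).trace =
      ∑ j, star (fun a => u (j, a)) ⬝ᵥ G *ᵥ fun a => u (j, a) := by
  simp_rw [← trace_vecMulVec_mul]
  rw [← Matrix.trace_sum, ← Matrix.sum_mul]
  congr 2
  ext a b
  simp [partialTrace_apply, vecMulVec_apply, Matrix.sum_apply]

/-- The set of all `tr_J P - tr_J (Δ P Δᴴ) + Q` with `P` and `Q` positive semidefinite. -/
def defectCone (Δ : Matrix (J × ι) (J × ι) ℂ) : Set (Matrix ι ι ℂ) :=
  {H | ∃ P Q, P.PosSemidef ∧ Q.PosSemidef ∧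
    H = partialTrace P - partialTrace (Δ * P * Δᴴ) + Q}

variable {Δ : Matrix (J × ι) (J × ι) ℂ}

lemma add_mem_defectCone {H K : Matrix ι ι ℂ} (hH : H ∈ defectCone Δ) (hK : K ∈ defectCone Δ) :
    H + K ∈ defectCone Δ := by
  obtain ⟨P, Q, hP, hQ, rfl⟩ := hH
  obtain ⟨P', Q', hP', hQ', rfl⟩ := hK
  refine ⟨P + P', Q + Q', hP.add hP', hQ.add hQ', ?_⟩
  simp only [Matrix.mul_add, Matrix.add_mul, map_add]
  abel

lemma smul_mem_defectCone {H : Matrix ι ι ℂ} (hH : H ∈ defectCone Δ) {t : ℝ} (ht : 0 ≤ t) :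
    t • H ∈ defectCone Δ := by
  obtain ⟨P, Q, hP, hQ, rfl⟩ := hH
  refine ⟨(t : ℂ) • P, (t : ℂ) • Q, hP.smul (by exact_mod_cast ht),
    hQ.smul (by exact_mod_cast ht), ?_⟩
  rw [← Complex.coe_smul]
  simp only [Matrix.mul_smul, Matrix.smul_mul, map_smul, smul_add, smul_sub]

lemma zero_mem_defectCone : (0 : Matrix ι ι ℂ) ∈ defectCone Δ :=
  ⟨0, 0, .zero, .zero, by simp⟩

lemma convex_defectCone : Convex ℝ (defectCone Δ) := fun _ hH _ hK _ _ ha hb _ =>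
  add_mem_defectCone (smul_mem_defectCone hH ha) (smul_mem_defectCone hK hb)

lemma exists_eq_mul_conjTranspose {P : Matrix ι ι ℂ} (hP : P.PosSemidef) :
    ∃ R : Matrix ι ι ℂ, P = R * Rᴴ := by
  classical
  open scoped MatrixOrder in
  obtain ⟨R, hR⟩ := CStarAlgebra.nonneg_iff_eq_mul_star_self.mp hP.nonneg
  exact ⟨R, hR⟩

lemma trace_partialTrace_sub_re (R : Matrix (J × ι) (J × ι) ℂ) :
    (partialTrace (R * Rᴴ) - partialTrace (Δ * (R * Rᴴ) * Δᴴ)).trace.re =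
      ∑ k, (nsq (R.col k) - nsq (Δ *ᵥ R.col k)) := by
  have h : Δ * (R * Rᴴ) * Δᴴ = (Δ * R) * (Δ * R)ᴴ := by
    simp [Matrix.conjTranspose_mul, Matrix.mul_assoc]
  rw [Matrix.trace_sub, trace_partialTrace, trace_partialTrace, h, Complex.sub_re,
    trace_mul_conjTranspose_self_re, trace_mul_conjTranspose_self_re, Finset.sum_sub_distrib]
  rfl

lemma norm_entry_le_of_sum_nsq_le {R : Matrix ι κ ℂ} {r : ℝ} (h : ∑ k, nsq (R.col k) ≤ r)
    (a : ι) (k : κ) : ‖R a k‖ ≤ r + 1 := by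
  have h1 : ‖R a k‖ ^ 2 ≤ nsq (R.col k) :=
    Finset.single_le_sum (f := fun a => ‖R a k‖ ^ 2) (fun _ _ => by positivity) (Finset.mem_univ a)
  have h2 : nsq (R.col k) ≤ ∑ k, nsq (R.col k) :=
    Finset.single_le_sum (f := fun k => nsq (R.col k)) (fun _ _ => nsq_nonneg _)
      (Finset.mem_univ k)
  nlinarith [sq_nonneg (‖R a k‖ - 1)]

lemma isClosed_defectCone {c : ℝ} (hc : c < 1) (hΔ : ∀ u, nsq (Δ *ᵥ u) ≤ c * nsq u) :
    IsClosed (defectCone Δ) := by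
  let Ψ : Matrix (J × ι) (J × ι) ℂ × Matrix ι ι ℂ → Matrix ι ι ℂ := fun R =>
    partialTrace (R.1 * R.1ᴴ) - partialTrace (Δ * (R.1 * R.1ᴴ) * Δᴴ) + R.2 * R.2ᴴ
  have hΨ : Continuous Ψ := by
    refine ((continuous_partialTrace.comp ?_).sub (continuous_partialTrace.comp ?_)).add ?_ <;>
      fun_prop
  refine isClosed_of_closure_subset fun H hH => ?_
  set M := H.trace.re + 1
  let U : Set (Matrix ι ι ℂ) := {K | K.trace.re < M}
  have hU : IsOpen U := isOpen_lt (by fun_prop) continuous_const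
  let B₁ : Set (Matrix (J × ι) (J × ι) ℂ) := {A | ∀ a b, ‖A a b‖ ≤ M / (1 - c) + 1}
  let B₂ : Set (Matrix ι ι ℂ) := {A | ∀ a b, ‖A a b‖ ≤ M + 1}
  have hB : IsCompact (Ψ '' B₁ ×ˢ B₂) :=
    ((isCompact_setOf_entries_le _ _ _).prod (isCompact_setOf_entries_le _ _ _)).image hΨ
  have hsub : U ∩ defectCone Δ ⊆ Ψ '' B₁ ×ˢ B₂ := by
    rintro _ ⟨hU, P, Q, hP, hQ, rfl⟩
    obtain ⟨R, rfl⟩ := exists_eq_mul_conjTranspose hP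
    obtain ⟨S, rfl⟩ := exists_eq_mul_conjTranspose hQ
    have hlt : ∑ k, (nsq (R.col k) - nsq (Δ *ᵥ R.col k)) + ∑ k, nsq (S.col k) < M := by
      rw [← trace_partialTrace_sub_re, ← trace_mul_conjTranspose_self_re, ← Complex.add_re,
        ← Matrix.trace_add]
      exact hU
    have hge : (1 - c) * ∑ k, nsq (R.col k) ≤ ∑ k, (nsq (R.col k) - nsq (Δ *ᵥ R.col k)) := by
      rw [Finset.mul_sum]
      exact Finset.sum_le_sum fun k _ => by linarith [hΔ (R.col k)]
    have hR : 0 ≤ ∑ k, nsq (R.col k) := Finset.sum_nonneg fun _ _ => nsq_nonneg _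
    have hS : 0 ≤ ∑ k, nsq (S.col k) := Finset.sum_nonneg fun _ _ => nsq_nonneg _
    have hc' : 0 < 1 - c := by linarith
    refine ⟨(R, S), ⟨?_, ?_⟩, rfl⟩
    · refine norm_entry_le_of_sum_nsq_le ?_
      rw [le_div_iff₀ hc']
      linarith
    · refine norm_entry_le_of_sum_nsq_le ?_
      nlinarith [mul_nonneg hc'.le hR]
  have h1 : H ∈ closure (U ∩ defectCone Δ) :=
    hU.inter_closure ⟨by simp [U, M], hH⟩
  obtain ⟨⟨R, S⟩, -, rfl⟩ := hB.isClosed.closure_subset_iff.2 hsub h1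
  exact ⟨_, _, posSemidef_self_mul_conjTranspose R, posSemidef_self_mul_conjTranspose S, rfl⟩

lemma exists_trace_representation [DecidableEq ι] (ℓ : Matrix ι ι ℂ →ₗ[ℝ] ℝ) :
    ∃ K : Matrix ι ι ℂ, ∀ A, ℓ A = (A * K).trace.re := by
  refine ⟨Matrix.of fun b a => (ℓ (Matrix.single a b 1) : ℂ) -
    Complex.I * ℓ (Matrix.single a b Complex.I), fun A => ?_⟩
  have hA : A = ∑ a, ∑ b, ((A a b).re • Matrix.single a b (1 : ℂ) +
      (A a b).im • Matrix.single a b Complex.I) := by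
    conv_lhs => rw [matrix_eq_sum_single A]
    refine Finset.sum_congr rfl fun a _ => Finset.sum_congr rfl fun b _ => ?_
    rw [Matrix.smul_single, Matrix.smul_single, ← Matrix.single_add]
    congr 1
    simp [Complex.re_add_im]
  conv_lhs => rw [hA]
  simp [map_sum, Matrix.trace, Matrix.mul_apply, -Matrix.smul_single]

/-- A Hermitian matrix lies in the defect cone as soon as it pairs nonnegatively with every positive
definite matrix for which `Δ` is a strict contraction. -/
theorem mem_defectCone [DecidableEq ι] {c : ℝ} (hc : c < 1)
    (hΔ : ∀ u, nsq (Δ *ᵥ u) ≤ c * nsq u) {H : Matrix ι ι ℂ} (hH : H.IsHermitian)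
    (h : ∀ G : Matrix ι ι ℂ, G.PosDef →
      (∀ u, u ≠ 0 → (∑ j, star (fun a => (Δ *ᵥ u) (j, a)) ⬝ᵥ G *ᵥ fun a => (Δ *ᵥ u) (j, a)).re <
        (∑ j, star (fun a => u (j, a)) ⬝ᵥ G *ᵥ fun a => u (j, a)).re) →
      0 ≤ (H * G).trace.re) :
    H ∈ defectCone Δ := by
  by_contra hmem
  have : LocallyConvexSpace ℝ (Matrix ι ι ℂ) :=
    inferInstanceAs (LocallyConvexSpace ℝ (ι → ι → ℂ))
  have : IsTopologicalAddGroup (Matrix ι ι ℂ) :=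
    inferInstanceAs (IsTopologicalAddGroup (ι → ι → ℂ))
  have : ContinuousSMul ℝ (Matrix ι ι ℂ) :=
    inferInstanceAs (ContinuousSMul ℝ (ι → ι → ℂ))
  obtain ⟨ℓ, s, hs, hcone⟩ := geometric_hahn_banach_point_closed convex_defectCone
    (isClosed_defectCone hc hΔ) hmem
  have hs0 : s < 0 := by simpa using hcone 0 zero_mem_defectCone
  have hneg : ℓ H < 0 := hs.trans hs0
  have hpos : ∀ K ∈ defectCone Δ, 0 ≤ ℓ K := by
    intro K hK
    by_contra! hlt
    have := hcone _ (smul_mem_defectCone hK (t := s / ℓ K) (div_nonneg_of_nonpos hs0.le hlt.le))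
    rw [map_smul, smul_eq_mul, div_mul_cancel₀ _ hlt.ne] at this
    exact lt_irrefl _ this
  obtain ⟨K, hK⟩ := exists_trace_representation (ℓ : Matrix ι ι ℂ →ₗ[ℝ] ℝ)
  replace hK : ∀ A, ℓ A = (A * K).trace.re := hK
  let G₀ : Matrix ι ι ℂ := (1 / 2 : ℂ) • (K + Kᴴ)
  have hG₀ : G₀.IsHermitian := by
    simp [G₀, Matrix.IsHermitian, Matrix.conjTranspose_smul, add_comm]
  have hrep : ∀ A : Matrix ι ι ℂ, A.IsHermitian → ℓ A = (A * G₀).trace.re := by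
    intro A hA
    have h1 : (A * Kᴴ).trace.re = (A * K).trace.re := by
      have : (A * Kᴴ).trace = star (A * K).trace := by
        rw [← Matrix.trace_conjTranspose, Matrix.conjTranspose_mul, hA.eq, Matrix.trace_mul_comm]
      rw [this]
      simp
    rw [hK]
    simp only [G₀, Matrix.mul_smul, Matrix.mul_add, Matrix.trace_smul, Matrix.trace_add, smul_add]
    simp [h1]
    ring
  have hG₀pos : G₀.PosSemidef := by
    refine .of_dotProduct_mulVec_nonneg hG₀ fun v => ?_
    have h1 : 0 ≤ ℓ (vecMulVec v (star v)) := hpos _ ⟨0, vecMulVec v (star v), .zero,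
      posSemidef_vecMulVec_self_star v, by simp⟩
    rw [hrep _ (posSemidef_vecMulVec_self_star v).1, trace_vecMulVec_mul] at h1
    refine Complex.nonneg_iff.2 ⟨h1, ?_⟩
    exact (hG₀.im_star_dotProduct_mulVec_self v).symm
  obtain ⟨ε, hε, hεH⟩ : ∃ ε : ℝ, 0 < ε ∧ ℓ H + ε * H.trace.re < 0 := by
    have hm : 0 < |H.trace.re| + 1 := by positivity
    have hε : 0 < -ℓ H / (2 * (|H.trace.re| + 1)) := div_pos (by linarith) (by positivity)
    refine ⟨_, hε, ?_⟩
    have h1 : -ℓ H / (2 * (|H.trace.re| + 1)) * (|H.trace.re| + 1) = -ℓ H / 2 := by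
      field_simp
    nlinarith [mul_le_mul_of_nonneg_left (le_abs_self H.trace.re) hε.le]
  have htr : ∀ A : Matrix ι ι ℂ, A.IsHermitian →
      (A * (G₀ + (ε : ℂ) • 1)).trace.re = ℓ A + ε * A.trace.re := by
    intro A hA
    rw [hrep A hA]
    simp [Matrix.mul_add]
  have hGpos : (G₀ + (ε : ℂ) • (1 : Matrix ι ι ℂ)).PosDef :=
    PosDef.posSemidef_add hG₀pos (Matrix.PosDef.one.smul (by exact_mod_cast hε))
  have := h _ hGpos fun u hu => by
    rw [← trace_partialTrace_vecMulVec_mul, ← trace_partialTrace_vecMulVec_mul, ← sub_pos,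
      ← Complex.sub_re, ← Matrix.trace_sub, ← Matrix.sub_mul]
    have hP := posSemidef_vecMulVec_self_star u
    have hΔu : vecMulVec (Δ *ᵥ u) (star (Δ *ᵥ u)) = Δ * vecMulVec u (star u) * Δᴴ := by
      rw [Matrix.mul_vecMulVec, Matrix.vecMulVec_mul, Matrix.star_mulVec]
    rw [htr]
    · have h1 := hpos _ ⟨_, 0, hP, .zero, rfl⟩
      rw [add_zero, ← hΔu] at h1
      have h2 : (partialTrace (vecMulVec u (star u)) -
          partialTrace (vecMulVec (Δ *ᵥ u) (star (Δ *ᵥ u)))).trace.re =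
          nsq u - nsq (Δ *ᵥ u) := by
        rw [Matrix.trace_sub, trace_partialTrace, trace_partialTrace, trace_vecMulVec,
          trace_vecMulVec, dotProduct_comm, ← nsq_eq_dotProduct, dotProduct_comm,
          ← nsq_eq_dotProduct]
        simp
      rw [h2]
      have h3 := hΔ u
      have h4 : 0 < ε * ((1 - c) * nsq u) := by
        have := nsq_pos hu
        have : 0 < 1 - c := by linarith
        positivity
      nlinarith
    · refine IsHermitian.sub ?_ ?_ <;>
      · rw [Matrix.IsHermitian, conjTranspose_partialTrace,
          (posSemidef_vecMulVec_self_star _).1.eq]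
  rw [htr H hH] at this
  linarith

end PositiveCone

section Factorization

open scoped ComplexOrder

variable {ι κ : Type*} [Fintype ι] [Fintype κ]

lemma nsq_mulVec_eq (M : Matrix κ ι ℂ) (v : ι → ℂ) :
    (nsq (M *ᵥ v) : ℂ) = star v ⬝ᵥ (Mᴴ * M) *ᵥ v := by
  rw [nsq_eq_dotProduct, Matrix.star_mulVec, ← Matrix.mulVec_mulVec, Matrix.dotProduct_mulVec,
    Matrix.dotProduct_mulVec, Matrix.dotProduct_mulVec]

/-- Douglas' factorization lemma for complex matrices. -/
lemma exists_contraction_mul_eq [DecidableEq κ] {M N : Matrix κ ι ℂ}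
    (h : (Mᴴ * M - Nᴴ * N).PosSemidef) :
    ∃ V : Matrix κ κ ℂ, (∀ v, nsq (V *ᵥ v) ≤ nsq v) ∧ N = V * M := by
  classical
  have hle : ∀ v, nsq (N *ᵥ v) ≤ nsq (M *ᵥ v) := by
    intro v
    have h1 := h.dotProduct_mulVec_nonneg v
    rw [Matrix.sub_mulVec, dotProduct_sub, ← nsq_mulVec_eq, ← nsq_mulVec_eq, sub_nonneg] at h1
    exact_mod_cast h1
  let f : (ι → ℂ) →ₗ[ℂ] EuclideanSpace ℂ κ :=
    (WithLp.linearEquiv 2 ℂ (κ → ℂ)).symm.toLinearMap ∘ₗ M.mulVecLin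
  have hker : LinearMap.ker f.rangeRestrict ≤ LinearMap.ker N.mulVecLin := by
    intro v hv
    have hv' : M *ᵥ v = 0 := by
      simpa [f, LinearMap.ker_rangeRestrict] using hv
    have := hle v
    rw [hv', nsq_eq_zero.2 rfl] at this
    exact nsq_eq_zero.1 (le_antisymm this (nsq_nonneg _))
  obtain ⟨g, hg⟩ : ∃ g : LinearMap.range f →ₗ[ℂ] (κ → ℂ), g ∘ₗ f.rangeRestrict = N.mulVecLin := by
    obtain ⟨s, hs⟩ := f.rangeRestrict.exists_rightInverse_of_surjective f.range_rangeRestrict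
    refine ⟨N.mulVecLin ∘ₗ s, LinearMap.ext fun v => ?_⟩
    have h1 : s (f.rangeRestrict v) - v ∈ LinearMap.ker f.rangeRestrict := by
      rw [LinearMap.mem_ker, map_sub, sub_eq_zero]
      exact LinearMap.congr_fun hs _
    have h2 := hker h1
    rw [LinearMap.mem_ker, map_sub, sub_eq_zero] at h2
    exact h2
  let T : EuclideanSpace ℂ κ →ₗ[ℂ] (κ → ℂ) :=
    g ∘ₗ ((LinearMap.range f).orthogonalProjectionOnto : EuclideanSpace ℂ κ →ₗ[ℂ] _)
  refine ⟨LinearMap.toMatrix' (T ∘ₗ (WithLp.linearEquiv 2 ℂ (κ → ℂ)).symm.toLinearMap), ?_, ?_⟩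
  · intro v
    rw [← Matrix.toLin'_apply, Matrix.toLin'_toMatrix']
    obtain ⟨w, hw⟩ := f.surjective_rangeRestrict
      ((LinearMap.range f).orthogonalProjectionOnto (WithLp.toLp 2 v))
    have h1 : (T ∘ₗ (WithLp.linearEquiv 2 ℂ (κ → ℂ)).symm.toLinearMap) v = N *ᵥ w := by
      have := LinearMap.congr_fun hg w
      rw [LinearMap.comp_apply, hw] at this
      exact this
    have h2 : nsq (M *ᵥ w) = ‖(LinearMap.range f).orthogonalProjectionOnto (WithLp.toLp 2 v)‖ ^ 2 := by
      rw [nsq_eq_norm_sq, ← hw]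
      rfl
    rw [h1]
    refine (hle w).trans ?_
    rw [h2, nsq_eq_norm_sq]
    gcongr
    exact (LinearMap.range f).norm_orthogonalProjectionOnto_apply_le _
  · apply Matrix.mulVec_injective
    funext v
    rw [← Matrix.mulVec_mulVec, ← Matrix.toLin'_apply (LinearMap.toMatrix' _),
      Matrix.toLin'_toMatrix']
    have h1 : (LinearMap.range f).orthogonalProjectionOnto (f v) = f.rangeRestrict v :=
      Submodule.orthogonalProjectionOnto_mem_subspace_eq_self (f.rangeRestrict v)
    have h2 := LinearMap.congr_fun hg v
    rw [LinearMap.comp_apply, ← h1] at h2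
    exact h2.symm

end Factorization

section TransferFunction

variable {J κ : Type*} [Fintype J] [Fintype κ]

section Algebra

variable {A B : Type*} [Ring A] [Algebra ℂ A] [Ring B] [Algebra ℂ B]

/-- The output of the colligation `V` when the input is `1` together with the family `a R`. -/
noncomputable def colligationOutput (V : Matrix (Option (J × κ)) (Option (J × κ)) ℂ)
    (a : J → J → A) (R : J × κ → A) (o : Option (J × κ)) : A :=
  V o none • 1 + ∑ l : J × κ, V o (some l) • ∑ j, a l.1 j * R (j, l.2)

/-- `R` is a state of the colligation `V` with feedback `a`. -/
def IsState (V : Matrix (Option (J × κ)) (Option (J × κ)) ℂ) (a : J → J → A)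
    (R : J × κ → A) : Prop :=
  ∀ l, R l = colligationOutput V a R (some l)

variable {V : Matrix (Option (J × κ)) (Option (J × κ)) ℂ}

lemma map_colligationOutput (ρ : A →ₐ[ℂ] B) (a : J → J → A) (R : J × κ → A)
    (o : Option (J × κ)) :
    ρ (colligationOutput V a R o) =
      colligationOutput V (fun i j => ρ (a i j)) (fun l => ρ (R l)) o := by
  simp [colligationOutput]

lemma IsState.map {a : J → J → A} {R : J × κ → A} (h : IsState V a R) (ρ : A →ₐ[ℂ] B) :
    IsState V (fun i j => ρ (a i j)) (fun l => ρ (R l)) := fun l => by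
  rw [← map_colligationOutput, ← h l]

lemma colligationOutput_prodMk (a : J → J → A) (b : J → J → B) (R : J × κ → A) (S : J × κ → B)
    (o : Option (J × κ)) :
    colligationOutput V (fun i j => (a i j, b i j)) (fun l => (R l, S l)) o =
      (colligationOutput V a R o, colligationOutput V b S o) := by
  have h1 := map_colligationOutput (V := V) (AlgHom.fst ℂ A B) (fun i j => (a i j, b i j))
    (fun l => (R l, S l)) o
  have h2 := map_colligationOutput (V := V) (AlgHom.snd ℂ A B) (fun i j => (a i j, b i j))
    (fun l => (R l, S l)) o
  exact Prod.ext h1 h2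

lemma IsState.prodMk {a : J → J → A} {b : J → J → B} {R : J × κ → A} {S : J × κ → B}
    (hR : IsState V a R) (hS : IsState V b S) :
    IsState V (fun i j => (a i j, b i j)) (fun l => (R l, S l)) := fun l => by
  rw [colligationOutput_prodMk, ← hR l, ← hS l]

end Algebra

variable {V : Matrix (Option (J × κ)) (Option (J × κ)) ℂ}

lemma sum_nsq_le_of_contraction {L ι : Type*} [Fintype L] [Fintype ι] {V : Matrix L L ℂ}
    (hV : ∀ v, nsq (V *ᵥ v) ≤ nsq v) (w : L → ι → ℂ) :
    ∑ o, nsq (∑ l, V o l • w l) ≤ ∑ o, nsq (w o) := by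
  have h : ∀ i, nsq (V *ᵥ fun l => w l i) ≤ nsq fun l => w l i := fun i => hV _
  calc ∑ o, nsq (∑ l, V o l • w l) = ∑ i, nsq (V *ᵥ fun l => w l i) := by
        simp only [nsq]
        rw [Finset.sum_comm]
        simp [mulVec, dotProduct]
    _ ≤ ∑ i, nsq fun l => w l i := Finset.sum_le_sum fun i _ => h i
    _ = ∑ o, nsq (w o) := by
        simp only [nsq]
        rw [Finset.sum_comm]

end TransferFunction

section Realization

variable {d J : ℕ} {κ : Type*} [Fintype κ]
  {V : Matrix (Option (Fin J × κ)) (Option (Fin J × κ)) ℂ}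
  {δ : Matrix (Fin J) (Fin J) (FreeAlgebra ℂ (Fin d))}

/-- The blocks of `δ(x)`. -/
noncomputable def evalBlocks {n : ℕ} (δ : Matrix (Fin J) (Fin J) (FreeAlgebra ℂ (Fin d)))
    (x : MatTuple d n) (i j : Fin J) : Matrix (Fin n) (Fin n) ℂ :=
  evalPoly (δ i j) x

lemma evalMat_mulVec {n : ℕ} (x : MatTuple d n) (u : Fin J × Fin n → ℂ) (a : Fin J × Fin n) :
    (evalMat δ x *ᵥ u) a = ∑ j, (evalBlocks δ x a.1 j *ᵥ fun i => u (j, i)) a.2 := by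
  unfold mulVec dotProduct
  simp [evalMat_apply, evalBlocks, Fintype.sum_prod_type]

lemma sum_nsq_feedback {n : ℕ} (x : MatTuple d n)
    (R : Fin J × κ → Matrix (Fin n) (Fin n) ℂ) (v : Fin n → ℂ) :
    ∑ l : Fin J × κ, nsq ((∑ j, evalBlocks δ x l.1 j * R (j, l.2)) *ᵥ v) =
      ∑ k, nsq (evalMat δ x *ᵥ fun a => (R (a.1, k) *ᵥ v) a.2) := by
  rw [Fintype.sum_prod_type_right]
  refine Finset.sum_congr rfl fun k _ => ?_
  rw [nsq_prod]
  refine Finset.sum_congr rfl fun j _ => ?_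
  congr 1
  funext i
  rw [evalMat_mulVec]
  simp [Matrix.sum_mulVec, Finset.sum_apply, ← Matrix.mulVec_mulVec]

lemma sum_nsq_state {n : ℕ} (R : Fin J × κ → Matrix (Fin n) (Fin n) ℂ) (v : Fin n → ℂ) :
    ∑ l, nsq (R l *ᵥ v) =
      ∑ k, nsq fun a : Fin J × Fin n => (R (a.1, k) *ᵥ v) a.2 := by
  rw [Fintype.sum_prod_type_right]
  refine Finset.sum_congr rfl fun k _ => ?_
  rw [nsq_prod]

lemma sum_nsq_feedback_le {n : ℕ} (x : MatTuple d n)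
    (R : Fin J × κ → Matrix (Fin n) (Fin n) ℂ) (v : Fin n → ℂ) :
    ∑ l : Fin J × κ, nsq ((∑ j, evalBlocks δ x l.1 j * R (j, l.2)) *ᵥ v) ≤
      opNorm (evalMat δ x) ^ 2 * ∑ l, nsq (R l *ᵥ v) := by
  rw [sum_nsq_feedback, sum_nsq_state, Finset.mul_sum]
  exact Finset.sum_le_sum fun k _ => nsq_mulVec_le _ _

lemma opNorm_sq_lt_one {n : ℕ} {x : MatTuple d n} (hx : x ∈ Gdel δ n) :
    opNorm (evalMat δ x) ^ 2 < 1 := by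
  have h1 : opNorm (evalMat δ x) < 1 := hx
  have h0 := opNorm_nonneg (evalMat δ x)
  nlinarith

lemma sum_nsq_colligationOutput_le (hV : ∀ v, nsq (V *ᵥ v) ≤ nsq v) {n : ℕ} (x : MatTuple d n)
    (R : Fin J × κ → Matrix (Fin n) (Fin n) ℂ) (v : Fin n → ℂ) :
    ∑ o, nsq (colligationOutput V (evalBlocks δ x) R o *ᵥ v) ≤
      nsq v + ∑ l : Fin J × κ, nsq ((∑ j, evalBlocks δ x l.1 j * R (j, l.2)) *ᵥ v) := by
  have := sum_nsq_le_of_contraction hV (fun o => o.elim v fun l =>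
    (∑ j, evalBlocks δ x l.1 j * R (j, l.2)) *ᵥ v)
  simpa [Fintype.sum_option, colligationOutput, Matrix.add_mulVec, Matrix.smul_mulVec,
    Matrix.sum_mulVec] using this

/-- The linear part of the state equation. -/
noncomputable def feedback (V : Matrix (Option (Fin J × κ)) (Option (Fin J × κ)) ℂ)
    (δ : Matrix (Fin J) (Fin J) (FreeAlgebra ℂ (Fin d))) {n : ℕ} (x : MatTuple d n) :
    Module.End ℂ (Fin J × κ → Matrix (Fin n) (Fin n) ℂ) where
  toFun R l := ∑ l' : Fin J × κ, V (some l) (some l') • ∑ j, evalBlocks δ x l'.1 j * R (j, l'.2)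
  map_add' R S := by
    funext l
    simp [mul_add, Finset.sum_add_distrib]
  map_smul' c R := by
    funext l
    simp [Finset.smul_sum, smul_comm c]

lemma isState_iff {n : ℕ} {x : MatTuple d n} {R : Fin J × κ → Matrix (Fin n) (Fin n) ℂ} :
    IsState V (evalBlocks δ x) R ↔
      (1 - feedback V δ x) R = fun l => V (some l) none • (1 : Matrix (Fin n) (Fin n) ℂ) := by
  simp only [IsState, colligationOutput, funext_iff, LinearMap.sub_apply,
    Module.End.one_apply, sub_eq_iff_eq_add]
  rfl

lemma injective_one_sub_feedback (hV : ∀ v, nsq (V *ᵥ v) ≤ nsq v) {n : ℕ} {x : MatTuple d n}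
    (hx : x ∈ Gdel δ n) : Function.Injective ⇑(1 - feedback V δ x) := by
  rw [injective_iff_map_eq_zero]
  intro R hR
  replace hR : R = feedback V δ x R := sub_eq_zero.1 hR
  have key : ∀ v, ∑ l, nsq (R l *ᵥ v) = 0 := by
    intro v
    have h1 := sum_nsq_le_of_contraction hV (fun o => o.elim 0 fun l =>
      (∑ j, evalBlocks δ x l.1 j * R (j, l.2)) *ᵥ v)
    have h2 : ∑ l, nsq (R l *ᵥ v) ≤
        ∑ l : Fin J × κ, nsq ((∑ j, evalBlocks δ x l.1 j * R (j, l.2)) *ᵥ v) := by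
      have h3 : ∀ l, R l *ᵥ v = ∑ l', V (some l) (some l') •
          ((∑ j, evalBlocks δ x l'.1 j * R (j, l'.2)) *ᵥ v) := by
        intro l
        conv_lhs => rw [hR]
        simp [feedback, Matrix.sum_mulVec, Matrix.smul_mulVec]
      simp only [Fintype.sum_option, Option.elim, smul_zero, zero_add,
        nsq_eq_zero.2 (rfl : (0 : Fin n → ℂ) = 0), ← h3] at h1
      exact le_trans (le_add_of_nonneg_left (nsq_nonneg _)) h1
    have h4 := sum_nsq_feedback_le (δ := δ) x R v
    have h5 := opNorm_sq_lt_one hx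
    have h6 : 0 ≤ ∑ l, nsq (R l *ᵥ v) := Finset.sum_nonneg fun _ _ => nsq_nonneg _
    nlinarith
  funext l
  apply Matrix.mulVec_injective
  funext v
  have := (Finset.sum_eq_zero_iff_of_nonneg fun l _ => nsq_nonneg (R l *ᵥ v)).1 (key v) l
    (Finset.mem_univ l)
  rw [nsq_eq_zero.1 this]
  simp

lemma exists_isState (hV : ∀ v, nsq (V *ᵥ v) ≤ nsq v) {n : ℕ} {x : MatTuple d n}
    (hx : x ∈ Gdel δ n) : ∃ R, IsState V (evalBlocks δ x) R := by
  obtain ⟨R, hR⟩ := LinearMap.injective_iff_surjective.1 (injective_one_sub_feedback hV hx)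
    fun l => V (some l) none • (1 : Matrix (Fin n) (Fin n) ℂ)
  exact ⟨R, isState_iff.2 hR⟩

lemma IsState.unique (hV : ∀ v, nsq (V *ᵥ v) ≤ nsq v) {n : ℕ} {x : MatTuple d n}
    (hx : x ∈ Gdel δ n) {R S : Fin J × κ → Matrix (Fin n) (Fin n) ℂ}
    (hR : IsState V (evalBlocks δ x) R) (hS : IsState V (evalBlocks δ x) S) : R = S :=
  injective_one_sub_feedback hV hx ((isState_iff.1 hR).trans (isState_iff.1 hS).symm)

open Classical in
/-- The transfer function of the colligation `V`. -/
noncomputable def transferFn (V : Matrix (Option (Fin J × κ)) (Option (Fin J × κ)) ℂ)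
    (δ : Matrix (Fin J) (Fin J) (FreeAlgebra ℂ (Fin d))) (n : ℕ) (x : MatTuple d n) :
    Matrix (Fin n) (Fin n) ℂ :=
  if h : ∃ R, IsState V (evalBlocks δ x) R then
    colligationOutput V (evalBlocks δ x) h.choose none else 0

lemma transferFn_eq (hV : ∀ v, nsq (V *ᵥ v) ≤ nsq v) {n : ℕ} {x : MatTuple d n}
    (hx : x ∈ Gdel δ n) {R : Fin J × κ → Matrix (Fin n) (Fin n) ℂ}
    (hR : IsState V (evalBlocks δ x) R) :
    transferFn V δ n x = colligationOutput V (evalBlocks δ x) R none := by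
  have h : ∃ R, IsState V (evalBlocks δ x) R := ⟨R, hR⟩
  rw [transferFn, dif_pos h, IsState.unique hV hx hR h.choose_spec]

/-- Conjugation by an invertible matrix as an algebra homomorphism. -/
noncomputable def conjHom {n : ℕ} {s : Matrix (Fin n) (Fin n) ℂ} (hs : IsUnit s) :
    Matrix (Fin n) (Fin n) ℂ →ₐ[ℂ] Matrix (Fin n) (Fin n) ℂ :=
  have hdet : IsUnit s.det := (Matrix.isUnit_iff_isUnit_det s).1 hs
  AlgHom.ofLinearMap
    { toFun := fun A => s⁻¹ * A * s
      map_add' := fun A B => by simp [mul_add, add_mul]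
      map_smul' := fun c A => by simp }
    (by simp [Matrix.nonsing_inv_mul _ hdet])
    (fun A B => by
      simp only [LinearMap.coe_mk, AddHom.coe_mk, mul_assoc]
      rw [Matrix.mul_nonsing_inv_cancel_left _ _ hdet])

@[simp] lemma conjHom_apply {n : ℕ} {s : Matrix (Fin n) (Fin n) ℂ} (hs : IsUnit s)
    (A : Matrix (Fin n) (Fin n) ℂ) : conjHom hs A = s⁻¹ * A * s := rfl

theorem isNCFn_transferFn (hV : ∀ v, nsq (V *ᵥ v) ≤ nsq v) :
    IsNCFn (Gdel δ) (transferFn V δ) where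
  map_dsum {m n} x y hx hy hxy := by
    obtain ⟨R, hR⟩ := exists_isState hV hx
    obtain ⟨S, hS⟩ := exists_isState hV hy
    have hblocks : evalBlocks δ (tdsum x y) =
        fun i j => mdsumHom m n (evalBlocks δ x i j, evalBlocks δ y i j) := by
      funext i j
      exact evalPoly_tdsum _ _ _
    have hRS := (hR.prodMk hS).map (mdsumHom m n)
    rw [← hblocks] at hRS
    rw [transferFn_eq hV hx hR, transferFn_eq hV hy hS, transferFn_eq hV hxy hRS, hblocks,
      ← map_colligationOutput, colligationOutput_prodMk]
    rfl
  map_sim {n} x s hs hx hxs := by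
    obtain ⟨R, hR⟩ := exists_isState hV hx
    have hblocks : evalBlocks δ (fun r => s⁻¹ * x r * s) =
        fun i j => conjHom hs (evalBlocks δ x i j) := by
      funext i j
      exact evalPoly_map (conjHom hs) _ _
    have hRs := hR.map (conjHom hs)
    rw [← hblocks] at hRs
    rw [transferFn_eq hV hx hR, transferFn_eq hV hxs hRs, hblocks, ← map_colligationOutput]
    rfl

theorem bddBy_transferFn (hV : ∀ v, nsq (V *ᵥ v) ≤ nsq v) :
    BddBy (Gdel δ) (transferFn V δ) 1 := by
  intro n x hx
  obtain ⟨R, hR⟩ := exists_isState hV hx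
  rw [transferFn_eq hV hx hR, opNorm_le_iff zero_le_one]
  intro v
  have h1 := sum_nsq_colligationOutput_le (δ := δ) hV x R v
  simp only [Fintype.sum_option, ← hR _] at h1
  have h2 := sum_nsq_feedback_le (δ := δ) x R v
  have h3 := opNorm_sq_lt_one hx
  have h4 : 0 ≤ ∑ l, nsq (R l *ᵥ v) := Finset.sum_nonneg fun _ _ => nsq_nonneg _
  nlinarith

end Realization

section Ampliation

open scoped Kronecker

variable {n : ℕ}

lemma kronecker_one_mulVec (A : Matrix (Fin n) (Fin n) ℂ) (u : Fin n × Fin n → ℂ)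
    (a : Fin n × Fin n) : ((A ⊗ₖ (1 : Matrix (Fin n) (Fin n) ℂ)) *ᵥ u) a =
      (A *ᵥ fun i => u (i, a.2)) a.1 := by
  simp [mulVec, dotProduct, Fintype.sum_prod_type, Matrix.one_apply]

/-- The representation `A ↦ S (A ⊗ 1) S⁻¹`. -/
noncomputable def ampHom {S : Matrix (Fin n × Fin n) (Fin n × Fin n) ℂ} (hS : IsUnit S.det) :
    Matrix (Fin n) (Fin n) ℂ →ₐ[ℂ] Matrix (Fin (n * n)) (Fin (n * n)) ℂ :=
  AlgHom.ofLinearMap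
    { toFun := fun A => Matrix.reindex finProdFinEquiv finProdFinEquiv
        (S * (A ⊗ₖ (1 : Matrix (Fin n) (Fin n) ℂ)) * S⁻¹)
      map_add' := fun A B => by
        rw [Matrix.add_kronecker, mul_add, add_mul]
        rfl
      map_smul' := fun c A => by
        rw [Matrix.smul_kronecker, Matrix.mul_smul, Matrix.smul_mul]
        rfl }
    (by
      simp only [LinearMap.coe_mk, AddHom.coe_mk, Matrix.one_kronecker_one, mul_one,
        Matrix.mul_nonsing_inv _ hS]
      exact map_one (Matrix.reindexAlgEquiv ℂ ℂ finProdFinEquiv))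
    (fun A B => by
      simp only [LinearMap.coe_mk, AddHom.coe_mk]
      have h : S * ((A * B) ⊗ₖ (1 : Matrix (Fin n) (Fin n) ℂ)) * S⁻¹ =
          (S * (A ⊗ₖ (1 : Matrix (Fin n) (Fin n) ℂ)) * S⁻¹) *
            (S * (B ⊗ₖ (1 : Matrix (Fin n) (Fin n) ℂ)) * S⁻¹) := by
        have h1 := Matrix.mul_kronecker_mul A B (1 : Matrix (Fin n) (Fin n) ℂ)
          (1 : Matrix (Fin n) (Fin n) ℂ)
        rw [mul_one] at h1
        rw [h1]
        simp only [mul_assoc, Matrix.nonsing_inv_mul_cancel_left _ _ hS]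
      rw [h]
      exact map_mul (Matrix.reindexAlgEquiv ℂ ℂ finProdFinEquiv) _ _)

variable {S : Matrix (Fin n × Fin n) (Fin n × Fin n) ℂ} (hS : IsUnit S.det)

lemma ampHom_apply (A : Matrix (Fin n) (Fin n) ℂ) (a b : Fin (n * n)) :
    ampHom hS A a b = (S * (A ⊗ₖ (1 : Matrix (Fin n) (Fin n) ℂ)) * S⁻¹)
      (finProdFinEquiv.symm a) (finProdFinEquiv.symm b) := rfl

lemma ampHom_mulVec (A : Matrix (Fin n) (Fin n) ℂ) (u : Fin n × Fin n → ℂ) :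
    ampHom hS A *ᵥ ((S *ᵥ u) ∘ finProdFinEquiv.symm) =
      (S *ᵥ ((A ⊗ₖ (1 : Matrix (Fin n) (Fin n) ℂ)) *ᵥ u)) ∘ finProdFinEquiv.symm := by
  have h1 : ampHom hS A = Matrix.submatrix (S * (A ⊗ₖ (1 : Matrix (Fin n) (Fin n) ℂ)) * S⁻¹)
    finProdFinEquiv.symm finProdFinEquiv.symm := rfl
  rw [h1, Matrix.submatrix_mulVec_equiv]
  congr 1
  rw [Equiv.symm_symm, Function.comp_assoc, Equiv.symm_comp_self, Function.comp_id, Matrix.mulVec_mulVec,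
    Matrix.mul_assoc, Matrix.nonsing_inv_mul _ hS, Matrix.mul_one, ← Matrix.mulVec_mulVec]

/-- The intertwiners between `A ↦ A` and `ampHom`. -/
noncomputable def ampIntertwiner (S : Matrix (Fin n × Fin n) (Fin n × Fin n) ℂ) (c : Fin n) :
    Matrix (Fin n) (Fin (n * n)) ℂ :=
  Matrix.of fun i b => S⁻¹ (i, c) (finProdFinEquiv.symm b)

lemma mul_ampIntertwiner_apply (A : Matrix (Fin n) (Fin n) ℂ) (c i : Fin n) (b : Fin (n * n)) :
    (A * ampIntertwiner S c) i b =
      ((A ⊗ₖ (1 : Matrix (Fin n) (Fin n) ℂ)) * S⁻¹) (i, c) (finProdFinEquiv.symm b) := by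
  simp [Matrix.mul_apply, ampIntertwiner, Fintype.sum_prod_type, Matrix.one_apply]

lemma ampIntertwiner_mul_apply (B : Matrix (Fin (n * n)) (Fin (n * n)) ℂ) (c i : Fin n)
    (b : Fin (n * n)) :
    (ampIntertwiner S c * B) i b =
      (S⁻¹ * B.submatrix finProdFinEquiv finProdFinEquiv) (i, c) (finProdFinEquiv.symm b) := by
  simp only [Matrix.mul_apply, ampIntertwiner, Matrix.of_apply, Matrix.submatrix_apply,
    Equiv.apply_symm_apply]
  rw [← Equiv.sum_comp finProdFinEquiv]
  simp

lemma forall_mul_ampIntertwiner_iff {A : Matrix (Fin n) (Fin n) ℂ}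
    {B : Matrix (Fin (n * n)) (Fin (n * n)) ℂ} :
    (∀ c, A * ampIntertwiner S c = ampIntertwiner S c * B) ↔ B = ampHom hS A := by
  have h1 : (∀ c, A * ampIntertwiner S c = ampIntertwiner S c * B) ↔
      (A ⊗ₖ (1 : Matrix (Fin n) (Fin n) ℂ)) * S⁻¹ =
        S⁻¹ * B.submatrix finProdFinEquiv finProdFinEquiv := by
    constructor
    · intro h
      ext ⟨i, c⟩ b
      have := congrFun (congrFun (h c) i) (finProdFinEquiv b)
      rwa [mul_ampIntertwiner_apply, ampIntertwiner_mul_apply, Equiv.symm_apply_apply] at this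
    · intro h c
      ext i b
      rw [mul_ampIntertwiner_apply, ampIntertwiner_mul_apply, h]
  rw [h1]
  constructor
  · intro h
    ext a b
    rw [ampHom_apply, Matrix.mul_assoc, h, Matrix.mul_nonsing_inv_cancel_left _ _ hS,
      Matrix.submatrix_apply, Equiv.apply_symm_apply, Equiv.apply_symm_apply]
  · rintro rfl
    have h2 : (ampHom hS A).submatrix finProdFinEquiv finProdFinEquiv =
        S * (A ⊗ₖ (1 : Matrix (Fin n) (Fin n) ℂ)) * S⁻¹ := by
      ext a b
      rw [Matrix.submatrix_apply, ampHom_apply]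
      simp
    rw [h2, Matrix.mul_assoc, Matrix.nonsing_inv_mul_cancel_left _ _ hS]

end Ampliation

section Interpolation

open scoped Kronecker ComplexOrder

variable {d J n : ℕ} {δ : Matrix (Fin J) (Fin J) (FreeAlgebra ℂ (Fin d))}

/-- The matrix `δ(x) ⊗ 1`. -/
noncomputable def evalAmp (δ : Matrix (Fin J) (Fin J) (FreeAlgebra ℂ (Fin d)))
    (x : MatTuple d n) : Matrix (Fin J × (Fin n × Fin n)) (Fin J × (Fin n × Fin n)) ℂ :=
  Matrix.of fun a b => (evalBlocks δ x a.1 b.1 ⊗ₖ (1 : Matrix (Fin n) (Fin n) ℂ)) a.2 b.2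

lemma evalAmp_mulVec (x : MatTuple d n) (u : Fin J × (Fin n × Fin n) → ℂ) (j : Fin J) :
    (fun a => (evalAmp δ x *ᵥ u) (j, a)) =
      ∑ j', (evalBlocks δ x j j' ⊗ₖ (1 : Matrix (Fin n) (Fin n) ℂ)) *ᵥ fun a => u (j', a) := by
  funext a
  rw [Finset.sum_apply]
  simp only [mulVec, dotProduct, evalAmp, Matrix.of_apply]
  rw [Fintype.sum_prod_type]

lemma evalAmp_mulVec_apply (x : MatTuple d n) (u : Fin J × (Fin n × Fin n) → ℂ)
    (j : Fin J) (i c : Fin n) :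
    (evalAmp δ x *ᵥ u) (j, (i, c)) = ∑ j', (evalBlocks δ x j j' *ᵥ fun i' => u (j', (i', c))) i := by
  have := congrFun (evalAmp_mulVec (δ := δ) x u j) (i, c)
  rw [Finset.sum_apply] at this
  simpa only [kronecker_one_mulVec] using this

lemma nsq_evalAmp_mulVec_le (x : MatTuple d n) (u : Fin J × (Fin n × Fin n) → ℂ) :
    nsq (evalAmp δ x *ᵥ u) ≤ opNorm (evalMat δ x) ^ 2 * nsq u := by
  have h : ∀ w : Fin J × (Fin n × Fin n) → ℂ,
      nsq w = ∑ c, nsq fun a : Fin J × Fin n => w (a.1, (a.2, c)) := by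
    intro w
    simp only [nsq, Fintype.sum_prod_type]
    symm
    rw [Finset.sum_comm]
    exact Finset.sum_congr rfl fun j _ => Finset.sum_comm
  rw [h, h u, Finset.mul_sum]
  refine Finset.sum_le_sum fun c _ => ?_
  have h1 : (fun a : Fin J × Fin n => (evalAmp δ x *ᵥ u) (a.1, (a.2, c))) =
      evalMat δ x *ᵥ fun a => u (a.1, (a.2, c)) := by
    funext a
    rw [evalAmp_mulVec_apply, evalMat_mulVec]
  rw [h1]
  exact nsq_mulVec_le _ _

lemma evalMat_ampHom_mulVec {S : Matrix (Fin n × Fin n) (Fin n × Fin n) ℂ} (hS : IsUnit S.det)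
    (x : MatTuple d n) (u : Fin J × (Fin n × Fin n) → ℂ) (j : Fin J) (b : Fin (n * n)) :
    (evalMat δ (fun r => ampHom hS (x r)) *ᵥ
      fun a => (S *ᵥ fun c => u (a.1, c)) (finProdFinEquiv.symm a.2)) (j, b) =
      (S *ᵥ fun c => (evalAmp δ x *ᵥ u) (j, c)) (finProdFinEquiv.symm b) := by
  rw [evalMat_mulVec, evalAmp_mulVec, Matrix.mulVec_sum, Finset.sum_apply]
  refine Finset.sum_congr rfl fun j' _ => ?_
  have h := congrFun (ampHom_mulVec hS (evalBlocks δ x j j') fun c => u (j', c)) b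
  rw [← show evalBlocks δ (fun r => ampHom hS (x r)) j j' = ampHom hS (evalBlocks δ x j j') from
    evalPoly_map (ampHom hS) _ _] at h
  exact h

lemma nsq_prod_comp_symm (w : Fin J → Fin n × Fin n → ℂ) :
    nsq (fun a : Fin J × Fin (n * n) => w a.1 (finProdFinEquiv.symm a.2)) = ∑ j, nsq (w j) := by
  rw [nsq_prod]
  exact Finset.sum_congr rfl fun j _ => nsq_comp_equiv finProdFinEquiv.symm (w j)

lemma re_dotProduct_conjTranspose_mul_self {ι : Type*} [Fintype ι] (S : Matrix ι ι ℂ)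
    (v : ι → ℂ) : (star v ⬝ᵥ (Sᴴ * S) *ᵥ v).re = nsq (S *ᵥ v) := by
  rw [← nsq_mulVec_eq, Complex.ofReal_re]

lemma ampHom_mem_Gdel {S : Matrix (Fin n × Fin n) (Fin n × Fin n) ℂ} (hS : IsUnit S.det)
    {x : MatTuple d n}
    (h : ∀ u : Fin J × (Fin n × Fin n) → ℂ, u ≠ 0 →
      (∑ j, star (fun a => (evalAmp δ x *ᵥ u) (j, a)) ⬝ᵥ (Sᴴ * S) *ᵥ
        fun a => (evalAmp δ x *ᵥ u) (j, a)).re <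
      (∑ j, star (fun a => u (j, a)) ⬝ᵥ (Sᴴ * S) *ᵥ fun a => u (j, a)).re) :
    (fun r => ampHom hS (x r)) ∈ Gdel δ (n * n) := by
  rw [Gdel, Set.mem_ofPred_eq, opNorm_lt_one_iff]
  intro v hv
  let u : Fin J × (Fin n × Fin n) → ℂ := fun a => (S⁻¹ *ᵥ fun c => v (a.1, finProdFinEquiv c)) a.2
  have huv : v = fun a => (S *ᵥ fun c => u (a.1, c)) (finProdFinEquiv.symm a.2) := by
    funext a
    have : (fun c => u (a.1, c)) = S⁻¹ *ᵥ fun c => v (a.1, finProdFinEquiv c) := rfl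
    rw [this, Matrix.mulVec_mulVec, Matrix.mul_nonsing_inv _ hS, Matrix.one_mulVec,
      Equiv.apply_symm_apply]
  have hu : u ≠ 0 := by
    intro h0
    apply hv
    rw [huv, h0]
    funext a
    exact congrFun (Matrix.mulVec_zero S) _
  have h1 := h u hu
  simp only [Complex.re_sum, re_dotProduct_conjTranspose_mul_self] at h1
  have h2 : evalMat δ (fun r => ampHom hS (x r)) *ᵥ v = fun a =>
      (S *ᵥ fun c => (evalAmp δ x *ᵥ u) (a.1, c)) (finProdFinEquiv.symm a.2) := by
    funext a
    rw [huv]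
    exact evalMat_ampHom_mulVec hS x u a.1 a.2
  rw [h2, huv, nsq_prod_comp_symm fun j => S *ᵥ fun c => (evalAmp δ x *ᵥ u) (j, c),
    nsq_prod_comp_symm fun j => S *ᵥ fun c => u (j, c)]
  exact h1

/-- The entries of a matrix as a vector. -/
def entries (A : Matrix (Fin n) (Fin n) ℂ) (p : Fin n × Fin n) : ℂ := A p.1 p.2

lemma kronecker_one_mulVec_entries_one (A : Matrix (Fin n) (Fin n) ℂ) :
    (A ⊗ₖ (1 : Matrix (Fin n) (Fin n) ℂ)) *ᵥ entries 1 = entries A := by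
  funext a
  rw [kronecker_one_mulVec]
  simp [entries, mulVec, dotProduct, Matrix.one_apply]

lemma nsq_mulVec_entries_le {S : Matrix (Fin n × Fin n) (Fin n × Fin n) ℂ} (hS : IsUnit S.det)
    {W : Matrix (Fin n) (Fin n) ℂ} (h : opNorm (ampHom hS W) ≤ 1) :
    nsq (S *ᵥ entries W) ≤ nsq (S *ᵥ entries 1) := by
  have h1 := (opNorm_le_iff zero_le_one).1 h ((S *ᵥ entries 1) ∘ finProdFinEquiv.symm)
  rwa [ampHom_mulVec, kronecker_one_mulVec_entries_one, nsq_comp_equiv, nsq_comp_equiv, one_pow,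
    one_mul] at h1

/-- The matrix with rows the vector `v` and the blocks of the columns of `R`. -/
def stackedRows {ι κ : Type*} (v : ι → ℂ) (R : Matrix (Fin J × ι) κ ℂ) :
    Matrix (Option (Fin J × κ)) ι ℂ :=
  Matrix.of fun o a => o.elim (v a) fun l => R (l.1, a) l.2

lemma stackedRows_gram {ι κ : Type*} [Fintype ι] [Fintype κ] (v : ι → ℂ)
    (R : Matrix (Fin J × ι) κ ℂ) :
    (stackedRows v R)ᴴ * stackedRows v R =
      (vecMulVec v (star v) + partialTrace (R * Rᴴ))ᵀ := by
  ext a b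
  simp [Matrix.mul_apply, stackedRows, Fintype.sum_option, Fintype.sum_prod_type, vecMulVec_apply,
    partialTrace_apply, mul_comm]

/-- The columns of `R` as families of `n × n` matrices. -/
def columnMatrices {κ : Type*} (R : Matrix (Fin J × (Fin n × Fin n)) κ ℂ) (l : Fin J × κ) :
    Matrix (Fin n) (Fin n) ℂ :=
  Matrix.of fun i c => R (l.1, (i, c)) l.2

lemma colligationOutput_columnMatrices {κ : Type*} [Fintype κ]
    (V : Matrix (Option (Fin J × κ)) (Option (Fin J × κ)) ℂ) (x : MatTuple d n)
    (R : Matrix (Fin J × (Fin n × Fin n)) κ ℂ) (o : Option (Fin J × κ)) (i c : Fin n) :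
    colligationOutput V (evalBlocks δ x) (columnMatrices R) o i c =
      (V * stackedRows (entries 1) (evalAmp δ x * R)) o (i, c) := by
  have h : ∀ l : Fin J × κ, (evalAmp δ x * R) (l.1, (i, c)) l.2 =
      ∑ j, (evalBlocks δ x l.1 j * columnMatrices R (j, l.2)) i c := fun l =>
    evalAmp_mulVec_apply x (fun a => R a l.2) l.1 i c
  rw [Matrix.mul_apply, Fintype.sum_option]
  simp [stackedRows, h, colligationOutput, Matrix.sum_apply, entries]

lemma exists_transferFn_eq {Λ : MatTuple d n} (hΛ : Λ ∈ Gdel δ n) {W : Matrix (Fin n) (Fin n) ℂ}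
    (h : vecMulVec (entries 1) (star (entries 1)) - vecMulVec (entries W) (star (entries W)) ∈
      defectCone (evalAmp δ Λ)) :
    ∃ V : Matrix (Option (Fin J × (Fin J × (Fin n × Fin n))))
        (Option (Fin J × (Fin J × (Fin n × Fin n)))) ℂ,
      (∀ v, nsq (V *ᵥ v) ≤ nsq v) ∧ transferFn V δ n Λ = W := by
  obtain ⟨P, Q, hP, hQ, hH⟩ := h
  obtain ⟨R, rfl⟩ := exists_eq_mul_conjTranspose hP
  have hpos : ((stackedRows (entries 1) (evalAmp δ Λ * R))ᴴ *
      stackedRows (entries 1) (evalAmp δ Λ * R) -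
      (stackedRows (entries W) R)ᴴ * stackedRows (entries W) R).PosSemidef := by
    rw [stackedRows_gram, stackedRows_gram, ← Matrix.transpose_sub]
    have h1 : evalAmp δ Λ * (R * Rᴴ) * (evalAmp δ Λ)ᴴ =
        (evalAmp δ Λ * R) * (evalAmp δ Λ * R)ᴴ := by
      simp [Matrix.conjTranspose_mul, Matrix.mul_assoc]
    rw [h1] at hH
    have h2 : vecMulVec (entries 1) (star (entries 1)) +
        partialTrace (evalAmp δ Λ * R * (evalAmp δ Λ * R)ᴴ) -
        (vecMulVec (entries W) (star (entries W)) + partialTrace (R * Rᴴ)) = Q := by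
      rw [add_sub_add_comm, hH]
      abel
    rw [h2]
    exact hQ.transpose
  obtain ⟨V, hV, hN⟩ := exists_contraction_mul_eq hpos
  have hstate : IsState V (evalBlocks δ Λ) (columnMatrices R) := by
    intro l
    ext i c
    rw [colligationOutput_columnMatrices, ← hN]
    rfl
  refine ⟨V, hV, ?_⟩
  rw [transferFn_eq hV hΛ hstate]
  ext i c
  rw [colligationOutput_columnMatrices, ← hN]
  rfl

/-- Interpolation at one point by a free function bounded by `1`. -/
theorem exists_interpolant {D : ∀ m, Set (MatTuple d m)}
    {f : ∀ m, MatTuple d m → Matrix (Fin m) (Fin m) ℂ} (hf : BddBy D f 1)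
    (hint : ∀ {m k : ℕ} (x : MatTuple d m) (y : MatTuple d k) (T : Matrix (Fin m) (Fin k) ℂ),
      x ∈ D m → y ∈ D k → (∀ r, x r * T = T * y r) → f m x * T = T * f k y)
    {Λ : MatTuple d n} (hΛD : Λ ∈ D n) (hΛ : Λ ∈ Gdel δ n)
    (hD : ∀ {m : ℕ} (ρ : Matrix (Fin n) (Fin n) ℂ →ₐ[ℂ] Matrix (Fin m) (Fin m) ℂ),
      (fun r => ρ (Λ r)) ∈ Gdel δ m → (fun r => ρ (Λ r)) ∈ D m) :
    ∃ φ : ∀ m, MatTuple d m → Matrix (Fin m) (Fin m) ℂ,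
      IsNCFn (Gdel δ) φ ∧ BddBy (Gdel δ) φ 1 ∧ φ n Λ = f n Λ := by
  suffices h : vecMulVec (entries 1) (star (entries 1)) -
      vecMulVec (entries (f n Λ)) (star (entries (f n Λ))) ∈ defectCone (evalAmp δ Λ) by
    obtain ⟨V, hV, hVΛ⟩ := exists_transferFn_eq hΛ h
    exact ⟨transferFn V δ, isNCFn_transferFn hV, bddBy_transferFn hV, hVΛ⟩
  refine mem_defectCone (opNorm_sq_lt_one hΛ) (nsq_evalAmp_mulVec_le Λ) ?_ ?_
  · refine Matrix.IsHermitian.sub ?_ ?_ <;>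
      exact (Matrix.posSemidef_vecMulVec_self_star _).isHermitian
  · intro G hG hlt
    obtain ⟨S, rfl⟩ : ∃ S : Matrix (Fin n × Fin n) (Fin n × Fin n) ℂ, G = Sᴴ * S := by
      open scoped MatrixOrder in
      exact CStarAlgebra.nonneg_iff_eq_star_mul_self.mp hG.posSemidef.nonneg
    have hS : IsUnit S.det := by
      have := (Matrix.isUnit_iff_isUnit_det _).1 hG.isUnit
      rw [Matrix.det_mul] at this
      exact isUnit_of_mul_isUnit_right this
    have hX := hD (ampHom hS) (ampHom_mem_Gdel hS hlt)
    have hfX : f (n * n) (fun r => ampHom hS (Λ r)) = ampHom hS (f n Λ) := by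
      rw [← forall_mul_ampIntertwiner_iff hS]
      exact fun c => hint _ _ _ hΛD hX fun r =>
        (forall_mul_ampIntertwiner_iff (A := Λ r) hS).2 rfl c
    have hle := nsq_mulVec_entries_le hS (hfX ▸ hf _ _ hX)
    rw [Matrix.sub_mul, Matrix.trace_sub, trace_vecMulVec_mul, trace_vecMulVec_mul, Complex.sub_re,
      re_dotProduct_conjTranspose_mul_self, re_dotProduct_conjTranspose_mul_self]
    linarith

end Interpolation

section LocalToGlobal

variable {d : ℕ} {D : ∀ m, Set (MatTuple d m)}
  {f : ∀ m, MatTuple d m → Matrix (Fin m) (Fin m) ℂ}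

/-- `f` agrees on `D`, near every point of `D`, with an nc-function on a basic free open set. -/
def IsLocallyNC (D : ∀ m, Set (MatTuple d m))
    (f : ∀ m, MatTuple d m → Matrix (Fin m) (Fin m) ℂ) : Prop :=
  ∀ n, ∀ x ∈ D n, ∃ (J : ℕ) (δ : Matrix (Fin J) (Fin J) (FreeAlgebra ℂ (Fin d)))
    (ψ : ∀ m, MatTuple d m → Matrix (Fin m) (Fin m) ℂ),
    x ∈ Gdel δ n ∧ IsNCFn (Gdel δ) ψ ∧ ∀ m, ∀ y ∈ D m, y ∈ Gdel δ m → ψ m y = f m y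

lemma IsNCFn.smul (c : ℂ) (h : IsNCFn D f) : IsNCFn D (fun n x => c • f n x) where
  map_dsum {m n} x y hx hy hxy := by
    rw [h.map_dsum x y hx hy hxy]
    exact (map_smul (mdsumHom m n) c (f m x, f n y)).symm
  map_sim x s hs hx hxs := by
    rw [h.map_sim x s hs hx hxs, Matrix.mul_smul, Matrix.smul_mul]

lemma IsLocallyNC.smul (c : ℂ) (h : IsLocallyNC D f) :
    IsLocallyNC D (fun n x => c • f n x) := fun n x hx => by
  obtain ⟨J, δ, ψ, hxδ, hψ, hψf⟩ := h n x hx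
  exact ⟨J, δ, _, hxδ, hψ.smul c, fun m y hy hyδ => by rw [hψf m y hy hyδ]⟩

variable {m n : ℕ}

lemma IsLocallyNC.map_tdsum (h : IsLocallyNC D f) {x : MatTuple d m} {y : MatTuple d n}
    (hx : x ∈ D m) (hy : y ∈ D n) (hxy : tdsum x y ∈ D (m + n)) :
    f (m + n) (tdsum x y) = mdsum (f m x) (f n y) := by
  obtain ⟨J, δ, ψ, hδ, hψ, hψf⟩ := h _ _ hxy
  obtain ⟨hxδ, hyδ⟩ := tdsum_mem_Gdel_iff.1 hδ
  rw [← hψf _ _ hxy hδ, ← hψf _ _ hx hxδ, ← hψf _ _ hy hyδ]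
  exact hψ.map_dsum x y hxδ hyδ hδ

/-- The block matrix with rows `(1, T)` and `(0, 1)`. -/
def shear (T : Matrix (Fin m) (Fin n) ℂ) : Matrix (Fin (m + n)) (Fin (m + n)) ℂ :=
  Matrix.reindex finSumFinEquiv finSumFinEquiv (Matrix.fromBlocks 1 T 0 1)

lemma isUnit_det_shear (T : Matrix (Fin m) (Fin n) ℂ) : IsUnit (shear T).det := by
  simp [shear]

lemma mdsum_mul_shear_eq_iff {A : Matrix (Fin m) (Fin m) ℂ} {B : Matrix (Fin n) (Fin n) ℂ}
    {T : Matrix (Fin m) (Fin n) ℂ} :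
    mdsum A B * shear T = shear T * mdsum A B ↔ A * T = T * B := by
  simp only [mdsum, shear, Matrix.reindex_apply, Matrix.submatrix_mul_equiv,
    Matrix.fromBlocks_multiply]
  rw [← Matrix.reindex_apply, ← Matrix.reindex_apply,
    (Matrix.reindex finSumFinEquiv finSumFinEquiv).injective.eq_iff, Matrix.fromBlocks_inj]
  simp

lemma IsLocallyNC.mul_eq_mul (h : IsLocallyNC D f) {x : MatTuple d m} {y : MatTuple d n}
    (hx : x ∈ D m) (hy : y ∈ D n) (hxy : tdsum x y ∈ D (m + n)) {T : Matrix (Fin m) (Fin n) ℂ}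
    (hT : ∀ r, x r * T = T * y r) : f m x * T = T * f n y := by
  obtain ⟨J, δ, ψ, hδ, hψ, hψf⟩ := h _ _ hxy
  have hs := isUnit_det_shear T
  have hconj : (fun r => (shear T)⁻¹ * tdsum x y r * shear T) = tdsum x y := by
    funext r
    rw [Matrix.mul_assoc, show tdsum x y r * shear T = shear T * tdsum x y r from
      mdsum_mul_shear_eq_iff.2 (hT r), Matrix.nonsing_inv_mul_cancel_left _ _ hs]
  have h1 := hψ.map_sim (tdsum x y) (shear T) ((Matrix.isUnit_iff_isUnit_det _).2 hs) hδ
    (by rwa [hconj])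
  rw [hconj, hψf _ _ hxy hδ, h.map_tdsum hx hy hxy] at h1
  rw [← mdsum_mul_shear_eq_iff]
  conv_rhs => rw [h1]
  rw [Matrix.mul_assoc, Matrix.mul_nonsing_inv_cancel_left _ _ hs]

end LocalToGlobal

section Compactness

lemma continuous_opNorm {ι : Type*} [Fintype ι] [DecidableEq ι] :
    Continuous (opNorm : Matrix ι ι ℂ → ℝ) :=
  continuous_norm.comp (LinearMap.continuous_of_finiteDimensional
    ((Matrix.toEuclideanCLM (𝕜 := ℂ) (n := ι)).toAlgEquiv.toLinearMap))

lemma opNorm_smul {ι : Type*} [Fintype ι] [DecidableEq ι] (c : ℂ) (A : Matrix ι ι ℂ) :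
    opNorm (c • A) = ‖c‖ * opNorm A := by
  rw [opNorm, map_smul, norm_smul, opNorm]

lemma opNorm_eq_zero {ι : Type*} [Fintype ι] [DecidableEq ι] {A : Matrix ι ι ℂ} :
    opNorm A = 0 ↔ A = 0 := by
  rw [opNorm, norm_eq_zero, EmbeddingLike.map_eq_zero_iff]

lemma norm_apply_le_opNorm {ι : Type*} [Fintype ι] [DecidableEq ι] (A : Matrix ι ι ℂ) (a b : ι) :
    ‖A a b‖ ≤ opNorm A := by
  have h1 := nsq_mulVec_le A (Pi.single b 1)
  have h2 : nsq (Pi.single b 1 : ι → ℂ) = 1 := by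
    simp [nsq, Pi.single_apply, apply_ite]
  have h3 : ‖A a b‖ ^ 2 ≤ nsq (A *ᵥ Pi.single b 1) := by
    rw [Matrix.mulVec_single_one]
    exact Finset.single_le_sum (f := fun i => ‖A i b‖ ^ 2) (fun _ _ => by positivity)
      (Finset.mem_univ a)
  rw [h2, mul_one] at h1
  exact (sq_le_sq₀ (norm_nonneg _) (opNorm_nonneg A)).1 (h3.trans h1)

variable {d : ℕ}

lemma isClosed_setOf_isNCFn (D : ∀ m, Set (MatTuple d m)) :
    IsClosed {φ : ∀ m, MatTuple d m → Matrix (Fin m) (Fin m) ℂ | IsNCFn D φ} := by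
  have hev : ∀ (n : ℕ) (x : MatTuple d n),
      Continuous fun φ : ∀ m, MatTuple d m → Matrix (Fin m) (Fin m) ℂ => φ n x :=
    fun n x => (continuous_apply x).comp (continuous_apply n)
  have hset : {φ : ∀ m, MatTuple d m → Matrix (Fin m) (Fin m) ℂ | IsNCFn D φ} =
      {φ | ∀ (m n : ℕ) (x : MatTuple d m) (y : MatTuple d n), x ∈ D m → y ∈ D n →
        tdsum x y ∈ D (m + n) → φ (m + n) (tdsum x y) = mdsum (φ m x) (φ n y)} ∩
      {φ | ∀ (n : ℕ) (x : MatTuple d n) (s : Matrix (Fin n) (Fin n) ℂ),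
        IsUnit s → x ∈ D n → (fun r => s⁻¹ * x r * s) ∈ D n →
        φ n (fun r => s⁻¹ * x r * s) = s⁻¹ * φ n x * s} :=
    Set.ext fun φ => ⟨fun h => ⟨fun _ _ => h.map_dsum, fun _ => h.map_sim⟩,
      fun h => ⟨h.1 _ _, h.2 _⟩⟩
  rw [hset]
  refine IsClosed.inter ?_ ?_
  · simp only [Set.ofPred_forall]
    refine isClosed_iInter fun m => isClosed_iInter fun n => isClosed_iInter fun x =>
      isClosed_iInter fun y => isClosed_iInter fun _ => isClosed_iInter fun _ =>
      isClosed_iInter fun _ => isClosed_eq (hev _ _) ?_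
    exact ((hev m x).matrix_fromBlocks continuous_const continuous_const (hev n y)).matrix_reindex
      _ _
  · simp only [Set.ofPred_forall]
    exact isClosed_iInter fun n => isClosed_iInter fun x => isClosed_iInter fun s =>
      isClosed_iInter fun _ => isClosed_iInter fun _ => isClosed_iInter fun _ =>
      isClosed_eq (hev _ _) ((continuous_const.matrix_mul (hev n x)).matrix_mul continuous_const)

lemma isClosed_setOf_bddBy (D : ∀ m, Set (MatTuple d m)) (c : ℝ) :
    IsClosed {φ : ∀ m, MatTuple d m → Matrix (Fin m) (Fin m) ℂ | BddBy D φ c} := by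
  simp only [BddBy, Set.ofPred_forall]
  exact isClosed_iInter fun n => isClosed_iInter fun x => isClosed_iInter fun _ =>
    isClosed_le (continuous_opNorm.comp ((continuous_apply x).comp (continuous_apply n)))
      continuous_const

/-- Pointwise interpolation on a set closed under direct sums implies simultaneous
interpolation. -/
theorem exists_extension_of_forall_exists {D E : ∀ m, Set (MatTuple d m)}
    {f : ∀ m, MatTuple d m → Matrix (Fin m) (Fin m) ℂ} (hne : ∃ (k : ℕ) (z : MatTuple d k), z ∈ D k)
    (hDE : ∀ m, D m ⊆ E m)
    (hD : ∀ {m n : ℕ} {x : MatTuple d m} {y : MatTuple d n}, x ∈ D m → y ∈ D n →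
      tdsum x y ∈ D (m + n))
    (hf : ∀ {m n : ℕ} {x : MatTuple d m} {y : MatTuple d n}, x ∈ D m → y ∈ D n →
      f (m + n) (tdsum x y) = mdsum (f m x) (f n y))
    (h : ∀ {n : ℕ} {x : MatTuple d n}, x ∈ D n →
      ∃ φ : ∀ m, MatTuple d m → Matrix (Fin m) (Fin m) ℂ,
        IsNCFn E φ ∧ BddBy E φ 1 ∧ φ n x = f n x) :
    ∃ φ : ∀ m, MatTuple d m → Matrix (Fin m) (Fin m) ℂ,
      IsNCFn E φ ∧ BddBy E φ 1 ∧ ∀ m, ∀ x ∈ D m, φ m x = f m x := by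
  let K : Set (∀ m, MatTuple d m → Matrix (Fin m) (Fin m) ℂ) :=
    Set.univ.pi fun m => Set.univ.pi fun _ => {A | ∀ a b, ‖A a b‖ ≤ 1}
  have hK : IsCompact K := isCompact_univ_pi fun m => isCompact_univ_pi fun _ =>
    isCompact_setOf_entries_le _ _ 1
  have hKc : IsClosed K := hK.isClosed
  let I := {p : Σ n, MatTuple d n // p.2 ∈ D p.1}
  obtain ⟨k, z, hz⟩ := hne
  have : Nonempty I := ⟨⟨⟨k, z⟩, hz⟩⟩
  let F : I → Set (∀ m, MatTuple d m → Matrix (Fin m) (Fin m) ℂ) := fun p =>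
    K ∩ ({φ | IsNCFn E φ} ∩ {φ | BddBy E φ 1} ∩ {φ | φ p.1.1 p.1.2 = f p.1.1 p.1.2})
  have hFc : ∀ p, IsClosed (F p) := fun p => hKc.inter
    (((isClosed_setOf_isNCFn E).inter (isClosed_setOf_bddBy E 1)).inter
      (isClosed_eq ((continuous_apply _).comp (continuous_apply _)) continuous_const))
  have hFk : ∀ p, IsCompact (F p) := fun p => hK.of_isClosed_subset (hFc p) Set.inter_subset_left
  have hFn : ∀ p, (F p).Nonempty := by
    classical
    rintro ⟨⟨n, x⟩, hx⟩
    obtain ⟨φ, hnc, hb, hφ⟩ := h hx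
    have hEq : ∀ {m : ℕ} {y : MatTuple d m}, y ∈ E m →
        (if y ∈ E m then φ m y else 0) = φ m y := fun hy => if_pos hy
    refine ⟨fun m y => if y ∈ E m then φ m y else 0, ?_, ⟨⟨?_, ?_⟩, ?_⟩⟩
    · intro m _ y _ a b
      by_cases hy : y ∈ E m
      · simpa [hy] using (norm_apply_le_opNorm _ a b).trans (hb m y hy)
      · simp [hy]
    · refine ⟨fun x y hx hy hxy => ?_, fun x s hs hx hxs => ?_⟩
      · rw [hEq hx, hEq hy, hEq hxy, hnc.map_dsum x y hx hy hxy]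
      · rw [hEq hx, hEq hxs, hnc.map_sim x s hs hx hxs]
    · intro m y hy
      simp only [hEq hy]
      exact hb m y hy
    · exact (hEq (hDE n hx)).trans hφ
  have hFd : Directed (· ⊇ ·) F := by
    rintro ⟨⟨m, x⟩, hx⟩ ⟨⟨n, y⟩, hy⟩
    refine ⟨⟨⟨m + n, tdsum x y⟩, hD hx hy⟩, ?_, ?_⟩
    all_goals
      rintro φ ⟨hφK, ⟨hnc, hb⟩, hφ⟩
      have h1 : φ (m + n) (tdsum x y) = f (m + n) (tdsum x y) := hφ
      rw [hf hx hy, hnc.map_dsum x y (hDE m hx) (hDE n hy) (hDE _ (hD hx hy))] at h1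
    · exact ⟨hφK, ⟨hnc, hb⟩, (mdsum_injective h1).1⟩
    · exact ⟨hφK, ⟨hnc, hb⟩, (mdsum_injective h1).2⟩
  obtain ⟨φ, hφ⟩ :=
    IsCompact.nonempty_iInter_of_directed_nonempty_isCompact_isClosed F hFd hFn hFk hFc
  rw [Set.mem_iInter] at hφ
  obtain ⟨_, ⟨hnc, hb⟩, _⟩ := hφ ⟨⟨k, z⟩, hz⟩
  exact ⟨φ, hnc, hb, fun m x hx => (hφ ⟨⟨m, x⟩, hx⟩).2.2⟩

end Compactness

section Extension

variable {d J : ℕ} {δ : Matrix (Fin J) (Fin J) (FreeAlgebra ℂ (Fin d))}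
  {γ : NonUnitalSubalgebra ℂ (FreeAlgebra ℂ (Fin d))}

lemma tdsum_mem_zeros {m n : ℕ} {x : MatTuple d m} {y : MatTuple d n}
    (hx : ∀ p ∈ γ, evalPoly p x = 0) (hy : ∀ p ∈ γ, evalPoly p y = 0) :
    ∀ p ∈ γ, evalPoly p (tdsum x y) = 0 := fun p hp => by
  rw [evalPoly_tdsum, hx p hp, hy p hp]
  exact map_zero (mdsumHom m n)

/-- Extension of functions bounded by `1`. -/
theorem exists_extension_of_bddBy_one {D : ∀ m, Set (MatTuple d m)}
    {f : ∀ m, MatTuple d m → Matrix (Fin m) (Fin m) ℂ}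
    (hD : ∀ m, D m = {x | (∀ p ∈ γ, evalPoly p x = 0) ∧ x ∈ Gdel δ m})
    (hne : ∃ (k : ℕ) (z : MatTuple d k), z ∈ D k) (hf : IsLocallyNC D f) (hb : BddBy D f 1) :
    ∃ φ : ∀ m, MatTuple d m → Matrix (Fin m) (Fin m) ℂ,
      IsNCFn (Gdel δ) φ ∧ BddBy (Gdel δ) φ 1 ∧ ∀ m, ∀ x ∈ D m, φ m x = f m x := by
  have hmem : ∀ {m : ℕ} {x : MatTuple d m},
      x ∈ D m ↔ (∀ p ∈ γ, evalPoly p x = 0) ∧ x ∈ Gdel δ m := fun {m x} => by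
    rw [hD]
    rfl
  have hsum : ∀ {m n : ℕ} {x : MatTuple d m} {y : MatTuple d n}, x ∈ D m → y ∈ D n →
      tdsum x y ∈ D (m + n) := fun hx hy =>
    hmem.2 ⟨tdsum_mem_zeros (hmem.1 hx).1 (hmem.1 hy).1,
      tdsum_mem_Gdel_iff.2 ⟨(hmem.1 hx).2, (hmem.1 hy).2⟩⟩
  refine exists_extension_of_forall_exists hne (fun m x hx => (hmem.1 hx).2) hsum
    (fun hx hy => hf.map_tdsum hx hy (hsum hx hy)) fun {n x} hx => ?_
  refine exists_interpolant hb (fun y z T hy hz hT => hf.mul_eq_mul hy hz (hsum hy hz) hT) hx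
    (hmem.1 hx).2 fun ρ hρ => hmem.2 ⟨fun p hp => ?_, hρ⟩
  rw [evalPoly_map, (hmem.1 hx).1 p hp, map_zero]

end Extension

/-- **Extension theorem** (Theorem 1.5).  Let `γ` be a subalgebra of `P^d`,
`V_γ = {x : p(x) = 0 ∀ p ∈ γ}`, and let `δ` be a `J × J` matrix of free polynomials with
`V_γ ∩ G_δ ≠ ∅`.  Every bounded free holomorphic function `f` on `V_γ ∩ G_δ` extends to a
free holomorphic function `φ` on `G_δ` with `‖φ‖_{H^∞(G_δ)} = sup {‖f(x)‖ : x ∈ V_γ ∩ G_δ}`. -/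
theorem extension_off_variety {d J : ℕ} (hd : 0 < d)
    (γ : NonUnitalSubalgebra ℂ (FreeAlgebra ℂ (Fin d)))
    (Vγ : ∀ m, Set (MatTuple d m))
    (hVγ : ∀ m, Vγ m = {x : MatTuple d m | ∀ p ∈ γ, evalPoly p x = 0})
    (δ : Matrix (Fin J) (Fin J) (FreeAlgebra ℂ (Fin d)))
    (hne : ∃ (k : ℕ) (z : MatTuple d k), z ∈ Vγ k ∩ Gdel δ k)
    (f : ∀ m, MatTuple d m → Matrix (Fin m) (Fin m) ℂ)
    (hbdd : ∃ C : ℝ, ∀ m, ∀ x ∈ Vγ m ∩ Gdel δ m, opNorm (f m x) ≤ C)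
    (hholo : ∀ n, ∀ x ∈ Vγ n ∩ Gdel δ n,
      ∃ (J' : ℕ) (δ' : Matrix (Fin J') (Fin J') (FreeAlgebra ℂ (Fin d)))
        (ψ : ∀ m, MatTuple d m → Matrix (Fin m) (Fin m) ℂ),
        x ∈ Gdel δ' n ∧ (∀ m, Gdel δ' m ⊆ Gdel δ m) ∧ IsFreeHolo (Gdel δ') ψ ∧
        ∀ m, ∀ y ∈ Vγ m ∩ Gdel δ' m, ψ m y = f m y) :
    ∃ φ : ∀ m, MatTuple d m → Matrix (Fin m) (Fin m) ℂ,
      IsFreeHolo (Gdel δ) φ ∧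
      (∀ m, ∀ x ∈ Vγ m ∩ Gdel δ m, φ m x = f m x) ∧
      sSup {r : ℝ | ∃ (m : ℕ) (x : MatTuple d m), x ∈ Gdel δ m ∧ r = opNorm (φ m x)} =
        sSup {r : ℝ | ∃ (m : ℕ) (x : MatTuple d m), x ∈ Vγ m ∩ Gdel δ m ∧ r = opNorm (f m x)} := by
  have hne' : ∃ (k : ℕ) (z : MatTuple d k), z ∈ (fun m => Vγ m ∩ Gdel δ m) k := hne
  set D : ∀ m, Set (MatTuple d m) := fun m => Vγ m ∩ Gdel δ m with hDdef
  set S : Set ℝ := {r : ℝ | ∃ (m : ℕ) (x : MatTuple d m), x ∈ Vγ m ∩ Gdel δ m ∧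
    r = opNorm (f m x)}
  have hD : ∀ m, D m = {x | (∀ p ∈ γ, evalPoly p x = 0) ∧ x ∈ Gdel δ m} := fun m => by
    rw [hDdef]
    simp only [hVγ m]
    rfl
  have hloc : IsLocallyNC D f := fun n x hx => by
    obtain ⟨J', δ', ψ, hxδ', -, hψ, hψf⟩ := hholo n x hx
    obtain ⟨J'', δ'', hxδ'', hsub, hnc, -⟩ := hψ n x hxδ'
    exact ⟨J'', δ'', ψ, hxδ'', hnc, fun m y hy hyδ => hψf m y ⟨hy.1, hsub m hyδ⟩⟩
  have hSb : BddAbove S := by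
    obtain ⟨C, hC⟩ := hbdd
    refine ⟨C, ?_⟩
    rintro _ ⟨m, x, hx, rfl⟩
    exact hC m x hx
  have hSn : S.Nonempty := by
    obtain ⟨k, z, hz⟩ := hne
    exact ⟨_, k, z, hz, rfl⟩
  have hfS : ∀ m, ∀ x ∈ D m, opNorm (f m x) ≤ sSup S := fun m x hx =>
    le_csSup hSb ⟨m, x, hx, rfl⟩
  have hS0 : 0 ≤ sSup S := by
    obtain ⟨k, z, hz⟩ := hne
    exact (opNorm_nonneg _).trans (hfS k z hz)
  have hnorm : ‖((sSup S : ℝ) : ℂ)‖ = sSup S := by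
    rw [Complex.norm_real, Real.norm_of_nonneg hS0]
  have hb : BddBy D (fun m x => ((sSup S : ℝ) : ℂ)⁻¹ • f m x) 1 := fun m x hx => by
    rw [opNorm_smul, norm_inv, hnorm, inv_mul_eq_div]
    exact div_le_one_of_le₀ (hfS m x hx) hS0
  obtain ⟨φ, hφ, hφb, hφf⟩ := exists_extension_of_bddBy_one hD hne' (hloc.smul _) hb
  have hφM : BddBy (Gdel δ) (fun m x => ((sSup S : ℝ) : ℂ) • φ m x) (sSup S) := fun m x hx => by
    rw [opNorm_smul, hnorm]
    exact mul_le_of_le_one_right hS0 (hφb m x hx)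
  have hext : ∀ m, ∀ x ∈ Vγ m ∩ Gdel δ m, ((sSup S : ℝ) : ℂ) • φ m x = f m x := fun m x hx => by
    rw [hφf m x hx]
    rcases eq_or_ne (sSup S) 0 with h0 | h0
    · have : f m x = 0 := opNorm_eq_zero.1 (le_antisymm (h0 ▸ hfS m x hx) (opNorm_nonneg _))
      rw [this, smul_zero, smul_zero]
    · exact smul_inv_smul₀ (by exact_mod_cast h0) _
  refine ⟨fun m x => ((sSup S : ℝ) : ℂ) • φ m x,
    fun n x hx => ⟨J, δ, hx, fun _ => subset_rfl, hφ.smul _, _, hφM⟩, hext, le_antisymm ?_ ?_⟩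
  · refine csSup_le ?_ ?_
    · obtain ⟨k, z, hz⟩ := hne
      exact ⟨_, k, z, hz.2, rfl⟩
    · rintro _ ⟨m, x, hx, rfl⟩
      exact hφM m x hx
  · refine csSup_le_csSup ⟨sSup S, ?_⟩ hSn ?_
    · rintro _ ⟨m, x, hx, rfl⟩
      exact hφM m x hx
    · rintro _ ⟨m, x, hx, rfl⟩
      exact ⟨m, x, hx.2, congrArg opNorm (hext m x hx).symm⟩
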